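/- Let p and q be prime numbers with p ≡ 5 (mod 8), q ≡ 3 (mod 8), and Legendre symbol (p/q) = 1. Then the class number of the multiquadratic field ℚ(√2, √p, √q) is odd. -/

import Mathlib

open NumberField Module Pointwise IntermediateField

theorem LinearMap.finrank_int_range_add_ker {M N : Type*} [AddCommGroup M] [AddCommGroup N]
    [Module.Finite ℤ M] (f : M →ₗ[ℤ] N) :
    finrank ℤ (LinearMap.range f) + finrank ℤ (LinearMap.ker f) = finrank ℤ M := by
  rw [← f.quotKerEquivRange.finrank_eq, Submodule.finrank_quotient_add_finrank]

theorem finrank_int_eq_zero_of_finite (M : Type*) [AddCommGroup M] [Finite M] :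
    finrank ℤ M = 0 := by
  rw [Module.finrank_eq_zero_iff_isTorsion]
  intro x
  exact ⟨⟨Nat.card M, mem_nonZeroDivisors_of_ne_zero (by exact_mod_cast Nat.card_pos.ne')⟩, by
    simp [Submonoid.smul_def]⟩

/-- The index of the subgroup of doubles in a finitely generated abelian group `G`. -/
theorem AddGroup.index_range_two_nsmul (G : Type*) [AddCommGroup G] [AddGroup.FG G] :
    (nsmulAddMonoidHom 2 : G →+ G).range.index =
      2 ^ finrank ℤ G * Nat.card (nsmulAddMonoidHom 2 : G →+ G).ker := by
  classical
  obtain ⟨n, ι, _, p, hp, a, ⟨e⟩⟩ := AddCommGroup.equiv_free_prod_directSum_zmod G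
  have (i : ι) : NeZero (p i ^ a i) := ⟨pow_ne_zero _ (hp i).ne_zero⟩
  set T := DirectSum ι fun i => ZMod (p i ^ a i)
  have : Finite T := Finite.of_equiv _ DFinsupp.equivFunOnFintype.symm
  have hfin : Module.Finite ℤ T := Module.Finite.of_finite
  have h1 : finrank ℤ G = n := by
    rw [e.toIntLinearEquiv.finrank_eq,
      ← LinearMap.finrank_int_range_add_ker (LinearMap.fst ℤ (Fin n →₀ ℤ) T),
      LinearMap.range_eq_top.2 Prod.fst_surjective, LinearMap.ker_fst, finrank_top,
      LinearMap.finrank_range_of_inj LinearMap.inr_injective, finrank_int_eq_zero_of_finite T]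
    simp
  have h2 : (nsmulAddMonoidHom 2 : G →+ G).range.index =
      (nsmulAddMonoidHom 2 : (Fin n →₀ ℤ) × T →+ _).range.index := by
    rw [← AddSubgroup.index_map_equiv _ e]
    congr 1
    ext x
    constructor
    · rintro ⟨_, ⟨y, rfl⟩, rfl⟩
      exact ⟨e y, by simp⟩
    · rintro ⟨y, rfl⟩
      exact ⟨_, ⟨e.symm y, rfl⟩, by simp⟩
  have h3 : Nat.card (nsmulAddMonoidHom 2 : G →+ G).ker =
      Nat.card (nsmulAddMonoidHom 2 : T →+ T).ker := by
    refine Nat.card_congr ⟨fun x => ⟨(e x.1).2, ?_⟩, fun t => ⟨e.symm (0, t.1), ?_⟩, ?_, ?_⟩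
    · have := x.2
      rw [AddMonoidHom.mem_ker, nsmulAddMonoidHom_apply] at this ⊢
      rw [← Prod.smul_snd, ← map_nsmul, this]; simp
    · have := t.2
      rw [AddMonoidHom.mem_ker, nsmulAddMonoidHom_apply] at this ⊢
      rw [← map_nsmul, Prod.smul_mk, this]; simp
    · intro x
      have := x.2
      rw [AddMonoidHom.mem_ker, nsmulAddMonoidHom_apply] at this
      have h : 2 • (e x.1).1 = 0 := by rw [← Prod.smul_fst, ← map_nsmul, this]; simp
      have h0 : (e x.1).1 = 0 := by simpa using h
      ext
      simp only
      rw [AddEquiv.symm_apply_eq]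
      ext1 <;> simp [h0]
    · intro t; ext; simp
  have h4 : (nsmulAddMonoidHom 2 : (Fin n →₀ ℤ) × T →+ _).range =
      (nsmulAddMonoidHom 2 : (Fin n →₀ ℤ) →+ _).range.prod
        (nsmulAddMonoidHom 2 : T →+ _).range := by
    ext ⟨x, y⟩
    simp [AddSubgroup.mem_prod, Prod.ext_iff]
  have h5 : (nsmulAddMonoidHom 2 : T →+ _).range.index =
      Nat.card (nsmulAddMonoidHom 2 : T →+ T).ker := by
    have e1 := (nsmulAddMonoidHom 2 : T →+ _).range.card_mul_index
    have e2 := (nsmulAddMonoidHom 2 : T →+ _).ker.card_mul_index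
    rw [AddSubgroup.index_ker, mul_comm] at e2
    exact Nat.eq_of_mul_eq_mul_left Nat.card_pos (e1.trans e2.symm)
  have h6 : (nsmulAddMonoidHom 2 : (Fin n →₀ ℤ) →+ _).range.index = 2 ^ n := by
    let f : (Fin n →₀ ℤ) →+ (Fin n → ZMod 2) :=
      { toFun := fun v i => (v i : ZMod 2)
        map_zero' := by ext; simp
        map_add' := by intros; ext; simp }
    have hf : f.ker = (nsmulAddMonoidHom 2 : (Fin n →₀ ℤ) →+ _).range := by
      ext v
      rw [AddMonoidHom.mem_ker]
      constructor
      · intro h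
        have (i : Fin n) : ∃ k, v i = 2 * k := by
          have := congrFun h i
          exact (ZMod.intCast_zmod_eq_zero_iff_dvd _ 2).1 this
        choose k hk using this
        exact ⟨Finsupp.equivFunOnFinite.symm k, by ext i; simp [hk]⟩
      · rintro ⟨w, rfl⟩
        ext i
        have : (2 : ZMod 2) = 0 := rfl
        simp [f, this]
    have hs : f.range = ⊤ := by
      rw [AddMonoidHom.range_eq_top]
      intro w
      refine ⟨Finsupp.equivFunOnFinite.symm fun i => (w i).val, ?_⟩
      ext i; simp [f]
    rw [← hf, AddSubgroup.index_ker, hs]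
    simp
  rw [h1, h2, h3, h4, AddSubgroup.index_prod, h5, h6]

theorem Group.index_range_sq (G : Type*) [CommGroup G] [Group.FG G] :
    (powMonoidHom 2 : G →* G).range.index =
      2 ^ finrank ℤ (Additive G) * Nat.card (powMonoidHom 2 : G →* G).ker :=
  AddGroup.index_range_two_nsmul (Additive G)

theorem gal_eq_one_or_eq {F L : Type*} [Field F] [NumberField F] [Field L] [Algebra F L]
    [Algebra.IsQuadraticExtension F L] {σ : Gal(L/F)} (hσ : σ ≠ 1) (g : Gal(L/F)) : g = 1 ∨ g = σ := by
  have h : Nat.card Gal(L/F) = 2 := by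
    rw [IsGaloisGroup.card_eq_finrank Gal(L/F) F L, Algebra.IsQuadraticExtension.finrank_eq_two]
  obtain ⟨x, y, hxy, huniv⟩ := Nat.card_eq_two_iff.1 h
  have key (z : Gal(L/F)) : z = x ∨ z = y := by
    have := Set.mem_univ z
    rw [← huniv] at this
    simpa using this
  rcases key g with h1 | h1 <;> rcases key σ with h2 | h2 <;> rcases key 1 with h3 | h3 <;>
    simp_all

theorem NumberField.RingOfIntegers.coe_gal_smul {F L : Type*} [Field F] [Field L] [Algebra F L]
    (σ : Gal(L/F)) (x : 𝓞 L) : ((σ • x : 𝓞 L) : L) = σ (x : L) := rfl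

section Quadratic

variable {F L : Type*} [Field F] [NumberField F] [Field L] [NumberField L] [Algebra F L]
  [Algebra.IsQuadraticExtension F L] {σ : Gal(L/F)}

omit [NumberField L] in
theorem gal_apply_apply (hσ : σ ≠ 1) (x : L) : σ (σ x) = x := by
  have : σ * σ = 1 := by
    rcases gal_eq_one_or_eq hσ (σ * σ) with h | h
    · exact h
    · exact absurd (mul_eq_left.1 h) hσ
  rw [← AlgEquiv.mul_apply, this, AlgEquiv.one_apply]

theorem algebraMap_norm_quadratic (hσ : σ ≠ 1) (x : L) :
    algebraMap F L (Algebra.norm F x) = x * σ x := by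
  classical
  rw [Algebra.norm_eq_prod_automorphisms]
  have : (Finset.univ : Finset Gal(L/F)) = {1, σ} := by
    ext g
    simpa using gal_eq_one_or_eq hσ g
  rw [this, Finset.prod_pair hσ.symm, AlgEquiv.one_apply]

theorem exists_algebraMap_eq_of_gal_fixed (hσ : σ ≠ 1) {x : L} (hx : σ x = x) :
    ∃ y : F, algebraMap F L y = x := by
  have := (IsGalois.mem_bot_iff_fixed (F := F) x).2 fun g => by
    rcases gal_eq_one_or_eq hσ g with rfl | rfl
    · rfl
    · exact hx
  exact IntermediateField.mem_bot.1 this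

theorem exists_units_map_eq_of_gal_fixed (hσ : σ ≠ 1) {u : (𝓞 L)ˣ} (hu : σ (u : L) = (u : L)) :
    ∃ v : (𝓞 F)ˣ, algebraMap F L (v : F) = (u : L) := by
  have key (w : (𝓞 L)ˣ) (hw : σ (w : L) = (w : L)) : ∃ y : 𝓞 F, algebraMap F L y = (w : L) := by
    obtain ⟨y, hy⟩ := exists_algebraMap_eq_of_gal_fixed hσ hw
    refine ⟨⟨y, ?_⟩, hy⟩
    have : IsIntegral ℤ (algebraMap F L y) := hy ▸ RingOfIntegers.isIntegral_coe _
    exact (isIntegral_algebraMap_iff (algebraMap F L).injective).1 this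
  have hmul : (u : L) * ((u⁻¹ : (𝓞 L)ˣ) : L) = 1 := by
    rw [← Units.coe_mul, mul_inv_cancel, Units.coe_one]
  obtain ⟨y, hy⟩ := key u hu
  obtain ⟨z, hz⟩ := key u⁻¹ (by
    have := congrArg σ hmul
    rw [map_mul, hu, map_one, ← hmul] at this
    exact mul_left_cancel₀ (Units.coe_ne_zero u) this)
  have hyz : y * z = 1 := by
    apply RingOfIntegers.ext
    apply (algebraMap F L).injective
    change algebraMap F L (algebraMap (𝓞 F) F (y * z)) = algebraMap F L (algebraMap (𝓞 F) F 1)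
    rw [map_mul, map_mul, hy, hz, hmul, map_one, map_one]
  exact ⟨⟨y, z, hyz, mul_comm z y ▸ hyz⟩, hy⟩

/-- Hilbert's theorem 90 for quadratic extensions, with an integral element as output. -/
theorem exists_integral_of_mul_gal_eq_one (hσ : σ ≠ 1) {x : L} (hx : x * σ x = 1) :
    ∃ b : 𝓞 L, b ≠ 0 ∧ x * σ (b : L) = b := by
  obtain ⟨b, hb, hxb⟩ : ∃ b : L, b ≠ 0 ∧ x * σ b = b := by
    by_cases h : x = -1
    · obtain ⟨y, hy⟩ : ∃ y, σ y ≠ y := by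
        by_contra! h
        exact hσ (AlgEquiv.ext h)
      refine ⟨y - σ y, sub_ne_zero.2 hy.symm, ?_⟩
      rw [h, map_sub, gal_apply_apply hσ]; ring
    · refine ⟨1 + x, fun h0 => h (by linear_combination h0), ?_⟩
      rw [map_add, map_one]; linear_combination hx
  obtain ⟨m, hm, hint⟩ := ((IsFractionRing.isAlgebraic_iff ℤ ℚ L).2
    (Algebra.IsAlgebraic.isAlgebraic b)).exists_integral_multiple
  refine ⟨⟨m • b, hint⟩, fun h => ?_, ?_⟩
  · have : m • b = 0 := congrArg (algebraMap (𝓞 L) L) h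
    exact smul_ne_zero hm hb this
  · change x * σ (m • b) = m • b
    rw [map_zsmul, mul_smul_comm, hxb]

end Quadratic

theorem card_sq_ker_eq_two {G : Type*} [CommGroup G] {a : G} (ha : a ≠ 1)
    (h : ∀ x : G, x ^ 2 = 1 ↔ x = 1 ∨ x = a) : Nat.card (powMonoidHom 2 : G →* G).ker = 2 := by
  rw [Nat.card_eq_two_iff]
  refine ⟨1, ⟨a, (h a).2 (Or.inr rfl)⟩, fun h1 => ha (congrArg Subtype.val h1).symm, ?_⟩
  ext ⟨x, hx⟩
  simpa [Subtype.ext_iff] using (h x).1 hx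

section Quadratic

variable {F L : Type*} [Field F] [NumberField F] [Field L] [NumberField L] [Algebra F L]
  [Algebra.IsQuadraticExtension F L] {σ : Gal(L/F)}

variable (F L) in
/-- The relative norm on units. -/
noncomputable def unitsNorm : (𝓞 L)ˣ →* (𝓞 F)ˣ := Units.map (RingOfIntegers.norm F)

theorem algebraMap_unitsNorm (hσ : σ ≠ 1) (u : (𝓞 L)ˣ) :
    algebraMap F L (unitsNorm F L u : F) = (u : L) * σ (u : L) :=
  algebraMap_norm_quadratic hσ (u : L)

theorem unitsNorm_eq_of_mul_gal_eq (hσ : σ ≠ 1) {u : (𝓞 L)ˣ} {v : (𝓞 F)ˣ}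
    (h : (u : L) * σ (u : L) = algebraMap F L (v : F)) : unitsNorm F L u = v := by
  apply Units.coe_injective F
  apply (algebraMap F L).injective
  rw [algebraMap_unitsNorm hσ, h]

theorem mem_ker_unitsNorm_iff (hσ : σ ≠ 1) {u : (𝓞 L)ˣ} :
    u ∈ (unitsNorm F L).ker ↔ (u : L) * σ (u : L) = 1 := by
  constructor
  · intro h
    rw [← algebraMap_unitsNorm hσ, MonoidHom.mem_ker.1 h]
    simp
  · intro h
    exact unitsNorm_eq_of_mul_gal_eq hσ (by simpa using h)

variable (σ) in
/-- The action of the Galois group on units. -/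
noncomputable def unitsGal : (𝓞 L)ˣ →* (𝓞 L)ˣ :=
  Units.map (MulSemiringAction.toRingHom Gal(L/F) (𝓞 L) σ : 𝓞 L →* 𝓞 L)

omit [NumberField F] [NumberField L] [Algebra.IsQuadraticExtension F L] in
theorem coe_unitsGal (u : (𝓞 L)ˣ) : (unitsGal σ u : L) = σ (u : L) := rfl

/-- The homomorphism `u ↦ u / σ u` into the units of relative norm one. -/
noncomputable def unitsTwist (hσ : σ ≠ 1) : (𝓞 L)ˣ →* (unitsNorm F L).ker :=
  (MonoidHom.id (𝓞 L)ˣ / unitsGal σ).codRestrict _ fun u => by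
    have h : (MonoidHom.id (𝓞 L)ˣ / unitsGal σ) u * unitsGal σ u = u := by simp
    have h' : unitsNorm F L (unitsGal σ u) = unitsNorm F L u :=
      unitsNorm_eq_of_mul_gal_eq hσ <| by
        rw [algebraMap_unitsNorm hσ, coe_unitsGal, gal_apply_apply hσ, mul_comm]
    have := congrArg (unitsNorm F L) h
    rw [map_mul, h'] at this
    exact mul_eq_right.1 this

theorem unitsTwist_eq_iff (hσ : σ ≠ 1) {u : (𝓞 L)ˣ} {v : (unitsNorm F L).ker} :
    unitsTwist hσ u = v ↔ (v.1 : L) * σ (u : L) = u := by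
  have h : unitsTwist hσ u = v ↔ u / unitsGal σ u = v.1 := Subtype.ext_iff
  rw [h, div_eq_iff_eq_mul, eq_comm, ← (Units.coe_injective L).eq_iff, Units.coe_mul, coe_unitsGal]

theorem map_unitsNorm_ker_unitsTwist (hσ : σ ≠ 1) :
    (unitsTwist hσ).ker.map (unitsNorm F L) = (powMonoidHom 2 : (𝓞 F)ˣ →* _).range := by
  ext v
  constructor
  · rintro ⟨u, hu, rfl⟩
    have hu : σ (u : L) = u := by
      simpa using (unitsTwist_eq_iff hσ).1 (MonoidHom.mem_ker.1 hu)
    obtain ⟨w, hw⟩ := exists_units_map_eq_of_gal_fixed hσ hu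
    refine ⟨w, (unitsNorm_eq_of_mul_gal_eq hσ ?_).symm⟩
    rw [hu, powMonoidHom_apply, Units.coe_pow, map_pow, hw, sq]
  · rintro ⟨w, rfl⟩
    have hw : algebraMap F L (w : F) =
        (Units.map (algebraMap (𝓞 F) (𝓞 L)).toMonoidHom w : (𝓞 L)ˣ) :=
      rfl
    refine ⟨Units.map (algebraMap (𝓞 F) (𝓞 L)).toMonoidHom w, ?_, ?_⟩
    · refine MonoidHom.mem_ker.2 ((unitsTwist_eq_iff hσ).2 ?_)
      rw [← hw, AlgEquiv.commutes]
      simp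
    · refine unitsNorm_eq_of_mul_gal_eq hσ ?_
      rw [← hw, AlgEquiv.commutes, powMonoidHom_apply, Units.coe_pow, map_pow, sq]

theorem unitsTwist_coe_ker (hσ : σ ≠ 1) (u : (unitsNorm F L).ker) :
    unitsTwist hσ u.1 = u ^ 2 := by
  rw [unitsTwist_eq_iff hσ]
  have := (mem_ker_unitsNorm_iff hσ).1 u.2
  change (((u.1 ^ 2 : (𝓞 L)ˣ)) : L) * _ = _
  rw [Units.coe_pow]
  linear_combination (u.1 : L) * this

theorem map_unitsTwist_ker_unitsNorm (hσ : σ ≠ 1) :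
    (unitsNorm F L).ker.map (unitsTwist hσ) =
      (powMonoidHom 2 : (unitsNorm F L).ker →* _).range := by
  ext v
  constructor
  · rintro ⟨u, hu, rfl⟩
    exact ⟨⟨u, hu⟩, (unitsTwist_coe_ker hσ ⟨u, hu⟩).symm⟩
  · rintro ⟨w, rfl⟩
    exact ⟨w.1, w.2, unitsTwist_coe_ker hσ w⟩

omit [NumberField F] [NumberField L] [Algebra F L] [Algebra.IsQuadraticExtension F L] in
theorem units_sq_eq_one_iff {R : Type*} [CommRing R] [IsDomain R] (u : Rˣ) :
    u ^ 2 = 1 ↔ u = 1 ∨ u = -1 := by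
  rw [← Units.val_inj, Units.val_pow_eq_pow_val, Units.val_one, sq_eq_one_iff, ← Units.val_inj,
    ← Units.val_inj]
  simp

theorem units_neg_one_ne_one (K : Type*) [Field K] [NumberField K] : (-1 : (𝓞 K)ˣ) ≠ 1 := by
  rw [Ne, ← Units.val_inj]
  simpa using neg_ne_self.2 (one_ne_zero (α := 𝓞 K))

theorem finrank_units_add_one (K : Type*) [Field K] [NumberField K] [IsTotallyReal K] :
    finrank ℤ (Additive (𝓞 K)ˣ) + 1 = finrank ℚ K := by
  rw [Units.finrank_eq, Units.rank, Nat.sub_add_cancel Fintype.card_pos, IsTotallyReal.finrank,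
    InfinitePlace.card_eq_nrRealPlaces_add_nrComplexPlaces, IsTotallyReal.nrComplexPlaces_eq_zero,
    add_zero]

theorem index_range_sq_units (K : Type*) [Field K] [NumberField K] [IsTotallyReal K] :
    (powMonoidHom 2 : (𝓞 K)ˣ →* _).range.index = 2 ^ finrank ℚ K := by
  have : Group.FG (𝓞 K)ˣ := Group.fg_iff_monoid_fg.2 inferInstance
  rw [Group.index_range_sq, card_sq_ker_eq_two (units_neg_one_ne_one K) units_sq_eq_one_iff,
    ← pow_succ, finrank_units_add_one]

theorem finrank_ker_unitsNorm (hσ : σ ≠ 1) [IsTotallyReal F] [IsTotallyReal L] :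
    finrank ℤ (Additive (unitsNorm F L).ker) = finrank ℚ F := by
  let f := (MonoidHom.toAdditive (unitsNorm F L)).toIntLinearMap
  have h1 := LinearMap.finrank_int_range_add_ker f
  have h2 : finrank ℤ (LinearMap.range f) = finrank ℤ (Additive (𝓞 F)ˣ) := by
    rw [← (LinearMap.range f).finrank_quotient_add_finrank, right_eq_add,
      Module.finrank_eq_zero_iff_isTorsion]
    rintro ⟨x⟩
    refine ⟨⟨2, mem_nonZeroDivisors_of_ne_zero two_ne_zero⟩, ?_⟩
    have hx : Additive.toMul x ^ 2 ∈ (unitsTwist hσ).ker.map (unitsNorm F L) := by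
      rw [map_unitsNorm_ker_unitsTwist]
      exact ⟨_, rfl⟩
    obtain ⟨u, -, hu⟩ := hx
    refine (Submodule.Quotient.mk_eq_zero _).2 ⟨Additive.ofMul u, ?_⟩
    exact hu
  have h3 : finrank ℤ (LinearMap.ker f) = finrank ℤ (Additive (unitsNorm F L).ker) :=
    (show LinearMap.ker f ≃+ Additive (unitsNorm F L).ker from
      { toFun := fun x => Additive.ofMul ⟨x.1.toMul, x.2⟩
        invFun := fun x => ⟨Additive.ofMul x.toMul.1, x.toMul.2⟩
        left_inv := fun x => rfl
        right_inv := fun x => rfl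
        map_add' := fun x y => rfl }).toIntLinearEquiv.finrank_eq
  have h4 := finrank_units_add_one F
  have h5 := finrank_units_add_one L
  have h6 := finrank_mul_finrank ℚ F L
  rw [Algebra.IsQuadraticExtension.finrank_eq_two F L] at h6
  lia

theorem index_range_sq_ker_unitsNorm (hσ : σ ≠ 1) [IsTotallyReal F] [IsTotallyReal L] :
    (powMonoidHom 2 : (unitsNorm F L).ker →* _).range.index = 2 * 2 ^ finrank ℚ F := by
  have : Module.Finite ℤ (Additive (unitsNorm F L).ker) :=
    Module.Finite.of_injective
      (MonoidHom.toAdditive (unitsNorm F L).ker.subtype).toIntLinearMap Subtype.val_injective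
  have : Group.FG (unitsNorm F L).ker := by
    rw [Group.fg_iff_monoid_fg, Monoid.fg_iff_add_fg, ← AddGroup.fg_iff_addMonoid_fg]
    exact Module.Finite.iff_addGroup_fg.1 this
  have hneg : (-1 : (𝓞 L)ˣ) ∈ (unitsNorm F L).ker := by
    rw [mem_ker_unitsNorm_iff hσ]; simp
  rw [Group.index_range_sq, finrank_ker_unitsNorm hσ, mul_comm,
    card_sq_ker_eq_two (a := ⟨-1, hneg⟩) (fun h => units_neg_one_ne_one L (congrArg Subtype.val h))]
  intro x
  rw [Subtype.ext_iff, Subtype.ext_iff, Subtype.ext_iff]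
  exact units_sq_eq_one_iff x.1

/-- The Herbrand quotient of the unit group of a totally real quadratic extension is `1 / 2`. -/
theorem index_range_unitsTwist (hσ : σ ≠ 1) [IsTotallyReal F] [IsTotallyReal L] :
    (unitsTwist hσ).range.index = 2 * (unitsNorm F L).range.index := by
  have h1 := Subgroup.index_map (unitsTwist hσ).ker (unitsNorm F L)
  have h2 := Subgroup.index_map (unitsNorm F L).ker (unitsTwist hσ)
  rw [map_unitsNorm_ker_unitsTwist, index_range_sq_units] at h1
  rw [map_unitsTwist_ker_unitsNorm, index_range_sq_ker_unitsNorm hσ, sup_comm] at h2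
  have h3 : ((unitsTwist hσ).ker ⊔ (unitsNorm F L).ker).index ≠ 0 := by
    intro h
    rw [h, zero_mul] at h1
    exact pow_ne_zero _ two_ne_zero h1
  apply Nat.eq_of_mul_eq_mul_left (Nat.pos_of_ne_zero h3)
  rw [← h2, h1]
  ring

end Quadratic

section IdealOrd

variable {R : Type*} [CommRing R] [IsDedekindDomain R]

open UniqueFactorizationMonoid

open Classical in
/-- The exponent of the ideal `P` in the factorization of `I`. -/
noncomputable def idealOrd (P I : Ideal R) : ℕ := (normalizedFactors I).count P

theorem idealOrd_mul (P : Ideal R) {I J : Ideal R} (hI : I ≠ ⊥) (hJ : J ≠ ⊥) :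
    idealOrd P (I * J) = idealOrd P I + idealOrd P J := by
  rw [idealOrd, normalizedFactors_mul hI hJ, Multiset.count_add, idealOrd, idealOrd]

theorem idealOrd_ne_zero_iff {P I : Ideal R} [hP : P.IsPrime] (hI : I ≠ ⊥) :
    idealOrd P I ≠ 0 ↔ I ≤ P := by
  classical
  rw [idealOrd, Multiset.count_ne_zero, Ideal.mem_normalizedFactors_iff hI]
  exact ⟨fun h => h.2, fun h => ⟨hP, h⟩⟩

theorem dvd_of_idealOrd_le {I J : Ideal R} (hI : I ≠ ⊥) (hJ : J ≠ ⊥)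
    (h : ∀ P : Ideal R, P.IsPrime → P ≠ ⊥ → I ≤ P → idealOrd P I ≤ idealOrd P J) : I ∣ J := by
  classical
  rw [dvd_iff_normalizedFactors_le_normalizedFactors hI hJ, Multiset.le_iff_count]
  intro P
  by_cases hP : P ∈ normalizedFactors I
  · have h1 := (Ideal.mem_normalizedFactors_iff hI).1 hP
    have h0 : P ≠ ⊥ := (prime_of_normalized_factor P hP).ne_zero
    simpa only [idealOrd] using h P h1.1 h0 h1.2
  · rw [Multiset.count_eq_zero_of_notMem hP]
    exact Nat.zero_le _

theorem pow_dvd_iff_le_idealOrd {P I : Ideal R} [hP : P.IsPrime] (hP0 : P ≠ ⊥) (hI : I ≠ ⊥)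
    (n : ℕ) : P ^ n ∣ I ↔ n ≤ idealOrd P I := by
  classical
  rw [dvd_iff_normalizedFactors_le_normalizedFactors (pow_ne_zero _ hP0) hI,
    normalizedFactors_pow,
    normalizedFactors_irreducible (Ideal.prime_of_isPrime hP0 hP).irreducible,
    normalize_eq, Multiset.nsmul_singleton, ← Multiset.le_count_iff_replicate_le, idealOrd]

theorem idealOrd_smul {G : Type*} [Group G] [MulSemiringAction G R] (g : G) {P I : Ideal R}
    [hP : P.IsPrime] (hP0 : P ≠ ⊥) (hI : I ≠ ⊥) : idealOrd (g • P) (g • I) = idealOrd P I := by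
  have key (J : Ideal R) (hJ : J ≠ ⊥) : g • J ≠ ⊥ := fun h => hJ <| by
    rw [← inv_smul_smul g J, h, Ideal.pointwise_smul_def, Ideal.map_bot]
  refine eq_of_forall_le_iff fun n => ?_
  have : (g • P).IsPrime := hP.smul g
  rw [← pow_dvd_iff_le_idealOrd hP0 hI, ← pow_dvd_iff_le_idealOrd (key P hP0) (key I hI),
    Ideal.dvd_iff_le, Ideal.dvd_iff_le, ← smul_pow', Ideal.pointwise_smul_le_pointwise_smul_iff]

end IdealOrd

section Quadratic

variable {F L : Type*} [Field F] [NumberField F] [Field L] [NumberField L] [Algebra F L]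
  [Algebra.IsQuadraticExtension F L] {σ : Gal(L/F)}

theorem card_inertia_eq_idealOrd (P : Ideal (𝓞 L)) [hP : P.IsPrime] (h0 : P ≠ ⊥) :
    Nat.card (P.inertia Gal(L/F)) =
      idealOrd P ((P.under (𝓞 F)).map (algebraMap (𝓞 F) (𝓞 L))) := by
  classical
  have hu : P.under (𝓞 F) ≠ ⊥ := mt Ideal.eq_bot_of_comap_eq_bot h0
  have : (P.under (𝓞 F)).IsMaximal := Ideal.IsPrime.isMaximal inferInstance hu
  have : Finite (𝓞 F ⧸ P.under (𝓞 F)) := Ideal.finiteQuotientOfFreeOfNeBot _ hu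
  have : Finite (P.under (𝓞 F)).ResidueField := Finite.of_surjective _
    (Ideal.bijective_algebraMap_quotient_residueField (P.under (𝓞 F))).2
  rw [Ideal.card_inertia_eq_ramificationIdxIn (P.under (𝓞 F)) P,
    Ideal.ramificationIdxIn_eq_ramificationIdx _ P Gal(L/F),
    Ideal.IsDedekindDomain.ramificationIdx_eq_normalizedFactors_count (P.under (𝓞 F)) P
      (Ideal.map_ne_bot_of_ne_bot hu)]
  unfold idealOrd
  congr!

theorem idealOrd_map_under_of_mem_inertia (hσ : σ ≠ 1) {P : Ideal (𝓞 L)} [P.IsPrime] (h0 : P ≠ ⊥)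
    (h : σ ∈ P.inertia Gal(L/F)) :
    idealOrd P ((P.under (𝓞 F)).map (algebraMap (𝓞 F) (𝓞 L))) = 2 := by
  have htop : P.inertia Gal(L/F) = ⊤ := by
    rw [eq_top_iff]
    rintro g -
    rcases gal_eq_one_or_eq hσ g with rfl | rfl
    · exact one_mem _
    · exact h
  rw [← card_inertia_eq_idealOrd P h0, htop, Subgroup.card_top,
    IsGaloisGroup.card_eq_finrank Gal(L/F) F L, Algebra.IsQuadraticExtension.finrank_eq_two F L]

theorem idealOrd_map_under_of_notMem_inertia (hσ : σ ≠ 1) {P : Ideal (𝓞 L)} [P.IsPrime]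
    (h0 : P ≠ ⊥) (h : σ ∉ P.inertia Gal(L/F)) :
    idealOrd P ((P.under (𝓞 F)).map (algebraMap (𝓞 F) (𝓞 L))) = 1 := by
  have hbot : P.inertia Gal(L/F) = ⊥ := by
    rw [eq_bot_iff]
    intro g hg
    rcases gal_eq_one_or_eq hσ g with rfl | rfl
    · exact one_mem _
    · exact absurd hg h
  rw [← card_inertia_eq_idealOrd P h0, hbot, Subgroup.card_bot]

omit [NumberField F] [NumberField L] [Algebra.IsQuadraticExtension F L] in
theorem smul_map_algebraMap (J : Ideal (𝓞 F)) (σ : Gal(L/F)) :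
    σ • J.map (algebraMap (𝓞 F) (𝓞 L)) = J.map (algebraMap (𝓞 F) (𝓞 L)) := by
  rw [Ideal.pointwise_smul_def, Ideal.map_map]
  congr 1
  refine RingHom.ext fun x => RingOfIntegers.ext ?_
  exact σ.commutes (x : F)

theorem exists_map_eq_of_smul_eq (hσ : σ ≠ 1) (I : Ideal (𝓞 L)) (hI : I ≠ ⊥) (hinv : σ • I = I)
    (heven : ∀ P : Ideal (𝓞 L), P.IsPrime → P ≠ ⊥ → σ ∈ P.inertia Gal(L/F) → Even (idealOrd P I)) :
    ∃ J : Ideal (𝓞 F), J.map (algebraMap (𝓞 F) (𝓞 L)) = I := by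
  induction I using WellFoundedGT.induction with
  | ind I ih =>
  by_cases htop : I = ⊤
  · exact ⟨⊤, by rw [htop, Ideal.map_top]⟩
  obtain ⟨P, hPm, hIP⟩ := Ideal.exists_le_maximal I htop
  have hP := hPm.isPrime
  have hP0 : P ≠ ⊥ := ne_bot_of_le_ne_bot hI hIP
  set 𝔭 := P.under (𝓞 F) with h𝔭
  have hu : 𝔭 ≠ ⊥ := mt Ideal.eq_bot_of_comap_eq_bot hP0
  have h𝔭m : 𝔭.IsMaximal := Ideal.IsPrime.isMaximal inferInstance hu
  set A := 𝔭.map (algebraMap (𝓞 F) (𝓞 L)) with hA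
  have hA0 : A ≠ ⊥ := Ideal.map_ne_bot_of_ne_bot hu
  have hunder (Q : Ideal (𝓞 L)) (hQ : Q.IsPrime) (hAQ : A ≤ Q) : Q.under (𝓞 F) = 𝔭 :=
    (h𝔭m.eq_of_le (Ideal.IsPrime.ne_top inferInstance) (Ideal.map_le_iff_le_comap.1 hAQ)).symm
  have hdvd : A ∣ I := by
    refine dvd_of_idealOrd_le hA0 hI fun Q hQ hQ0 hAQ => ?_
    have hQu := hunder Q hQ hAQ
    have : Q.LiesOver 𝔭 := ⟨hQu.symm⟩
    have : P.LiesOver 𝔭 := ⟨rfl⟩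
    obtain ⟨g, rfl⟩ := Ideal.exists_smul_eq_of_isGaloisGroup 𝔭 P Q Gal(L/F)
    have hgI : g • I = I := by
      rcases gal_eq_one_or_eq hσ g with rfl | rfl
      · rw [one_smul]
      · exact hinv
    have hpos : idealOrd (g • P) I ≠ 0 := by
      rw [idealOrd_ne_zero_iff hI, ← hgI]
      exact Ideal.pointwise_smul_le_pointwise_smul_iff.2 hIP
    by_cases hin : σ ∈ (g • P).inertia Gal(L/F)
    · have h1 := idealOrd_map_under_of_mem_inertia hσ hQ0 hin
      rw [hQu] at h1
      rw [h1]
      obtain ⟨k, hk⟩ := heven _ hQ hQ0 hin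
      lia
    · have h1 := idealOrd_map_under_of_notMem_inertia hσ hQ0 hin
      rw [hQu] at h1
      rw [h1]
      lia
  obtain ⟨B, hB⟩ := hdvd
  have hB0 : B ≠ ⊥ := by
    rintro rfl
    exact hI (by rw [hB, Ideal.mul_bot])
  obtain ⟨J, hJ⟩ := ih B (by
    refine lt_of_le_of_ne (Ideal.le_of_dvd ⟨A, by rw [mul_comm, ← hB]⟩) fun h => ?_
    rw [← h] at hB
    have : A = 1 := mul_right_cancel₀ hI (by rw [← hB, one_mul])
    exact hP.ne_top (top_le_iff.1 (by rw [← Ideal.one_eq_top, ← this]; exact Ideal.map_comap_le)))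
    hB0 (by
      rw [hB, smul_mul', hA, smul_map_algebraMap] at hinv
      exact mul_left_cancel₀ hA0 hinv) (by
      intro Q hQ hQ0 hin
      have h1 := heven Q hQ hQ0 hin
      rw [hB, idealOrd_mul Q hA0 hB0] at h1
      have h2 : Even (idealOrd Q A) := by
        by_cases hAQ : A ≤ Q
        · have h1 := idealOrd_map_under_of_mem_inertia hσ hQ0 hin
          rw [hunder Q hQ hAQ] at h1
          rw [h1]
          exact even_two
        · rw [← idealOrd_ne_zero_iff hA0, not_not] at hAQ
          rw [hAQ]
          exact Even.zero
      exact (Nat.even_add.1 h1).1 h2)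
  exact ⟨𝔭 * J, by rw [Ideal.map_mul, hJ, hB]⟩

end Quadratic

section ClassGroup

variable {R : Type*} [CommRing R] [IsDedekindDomain R]

theorem ClassGroup.mk0_pow_eq_one_iff {I : Ideal R} (hI : I ∈ nonZeroDivisors (Ideal R)) (n : ℕ) :
    ClassGroup.mk0 ⟨I, hI⟩ ^ n = 1 ↔ (I ^ n).IsPrincipal := by
  rw [← ClassGroup.mk0_eq_one_iff (pow_mem hI n), ← map_pow, SubmonoidClass.mk_pow]

theorem Ideal.isPrincipal_pow_card_classGroup (I : Ideal R) :
    (I ^ Nat.card (ClassGroup R)).IsPrincipal := by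
  by_cases hI : I = ⊥
  · rw [hI]
    by_cases h : Nat.card (ClassGroup R) = 0
    · rw [h, pow_zero, Ideal.one_eq_top]; exact top_isPrincipal
    · rw [← Ideal.zero_eq_bot, zero_pow h]; exact bot_isPrincipal
  · exact (ClassGroup.mk0_pow_eq_one_iff (mem_nonZeroDivisors_of_ne_zero hI) _).1 pow_card_eq_one'

theorem exists_sq_isPrincipal_of_even_card_classGroup [Finite (ClassGroup R)]
    (h : Even (Nat.card (ClassGroup R))) :
    ∃ I : Ideal R, I ≠ ⊥ ∧ (I ^ 2).IsPrincipal ∧ ¬ I.IsPrincipal := by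
  obtain ⟨c, hc⟩ := exists_prime_orderOf_dvd_card' (G := ClassGroup R) 2 h.two_dvd
  obtain ⟨⟨I, hI⟩, rfl⟩ := ClassGroup.mk0_surjective c
  refine ⟨I, nonZeroDivisors.ne_zero hI, ?_, fun hP => ?_⟩
  · rw [← ClassGroup.mk0_pow_eq_one_iff hI, ← hc, pow_orderOf_eq_one]
  · rw [(ClassGroup.mk0_eq_one_iff hI).2 hP, orderOf_one] at hc
    exact absurd hc (by norm_num)

theorem Ideal.isPrincipal_of_sq_of_odd_pow {I : Ideal R} (hI : I ≠ ⊥) (h2 : (I ^ 2).IsPrincipal)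
    {n : ℕ} (hn : Odd n) (h : (I ^ n).IsPrincipal) : I.IsPrincipal := by
  have hI' := mem_nonZeroDivisors_of_ne_zero hI
  rw [← ClassGroup.mk0_eq_one_iff hI']
  rw [← ClassGroup.mk0_pow_eq_one_iff hI'] at h h2
  obtain ⟨k, rfl⟩ := hn
  rwa [pow_succ, pow_mul, h2, one_pow, one_mul] at h

theorem Ideal.isPrincipal_of_mul_isPrincipal {I : Ideal R} {b : R} (hb : b ≠ 0)
    (h : (I * Ideal.span {b}).IsPrincipal) : I.IsPrincipal := by
  obtain ⟨c, hc⟩ := h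
  rw [Ideal.submodule_span_eq] at hc
  have hcb : c ∈ Ideal.span {b} :=
    (Ideal.span_singleton_le_iff_mem _).1 (hc.symm.le.trans Ideal.mul_le_right)
  obtain ⟨d, rfl⟩ := Ideal.mem_span_singleton'.1 hcb
  have hb' : Ideal.span {b} ≠ ⊥ := by simpa using hb
  have : I = Ideal.span {d} := by
    apply mul_right_cancel₀ hb'
    rw [hc, Ideal.span_singleton_mul_span_singleton]
  exact ⟨d, this⟩

end ClassGroup

section Quadratic

variable {F L : Type*} [Field F] [NumberField F] [Field L] [NumberField L] [Algebra F L]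
  [Algebra.IsQuadraticExtension F L] {σ : Gal(L/F)}

omit [NumberField F] [NumberField L] [Algebra.IsQuadraticExtension F L] in
theorem span_smul_eq_of_mul_gal_eq {u : (𝓞 L)ˣ} {b : 𝓞 L} (h : (u : L) * σ (b : L) = b) :
    σ • Ideal.span {b} = Ideal.span {b} := by
  have h' : u * (σ • b) = b := RingOfIntegers.ext h
  rw [Ideal.pointwise_smul_def, Ideal.map_span, Set.image_singleton]
  refine Ideal.span_singleton_eq_span_singleton.2 ⟨u, ?_⟩
  rw [mul_comm]; exact h'

theorem mem_range_unitsTwist_of_even (hσ : σ ≠ 1) (hF : Odd (Nat.card (ClassGroup (𝓞 F))))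
    {u : (unitsNorm F L).ker} {b : 𝓞 L} (hb : b ≠ 0) (h : (u.1 : L) * σ (b : L) = b)
    (heven : ∀ P : Ideal (𝓞 L), P.IsPrime → P ≠ ⊥ → σ ∈ P.inertia Gal(L/F) →
      Even (idealOrd P (Ideal.span {b}))) :
    u ∈ (unitsTwist hσ).range := by
  obtain ⟨J, hJ⟩ := exists_map_eq_of_smul_eq hσ _ (by simpa using hb)
    (span_smul_eq_of_mul_gal_eq h) heven
  obtain ⟨f, hf⟩ := J.isPrincipal_pow_card_classGroup
  rw [Ideal.submodule_span_eq] at hf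
  set n := Nat.card (ClassGroup (𝓞 F))
  have h1 : Ideal.span {algebraMap (𝓞 F) (𝓞 L) f} = Ideal.span {b ^ n} := by
    rw [← Ideal.span_singleton_pow, ← hJ, ← Ideal.map_pow, hf, Ideal.map_span,
      Set.image_singleton]
  obtain ⟨η, hη⟩ := Ideal.span_singleton_eq_span_singleton.1 h1
  have hη' : algebraMap F L f * (η : L) = (b : L) ^ n := congrArg (algebraMap (𝓞 L) L) hη
  have hf0 : algebraMap F L f ≠ 0 := by
    intro h0
    rw [h0, zero_mul] at hη'
    exact hb (RingOfIntegers.ext (pow_eq_zero_iff hF.pos.ne' |>.1 hη'.symm))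
  have hun : u ^ n ∈ (unitsTwist hσ).range := by
    refine MonoidHom.mem_range.2 ⟨η, (unitsTwist_eq_iff hσ).2 ?_⟩
    apply mul_left_cancel₀ hf0
    have h2 := congrArg σ hη'
    rw [map_mul, AlgEquiv.commutes, map_pow] at h2
    rw [hη', ← h, mul_pow, ← h2]
    simp
    ring
  obtain ⟨k, hk⟩ := hF
  have h2 : (u ^ 2) ^ k ∈ (unitsTwist hσ).range :=
    pow_mem (MonoidHom.mem_range.2 ⟨u.1, unitsTwist_coe_ker hσ u⟩) k
  rw [show n = 2 * k + 1 from hk, pow_succ, pow_mul] at hun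
  exact (Subgroup.mul_mem_cancel_left _ h2).1 hun

theorem index_range_unitsTwist_le (hσ : σ ≠ 1) (hF : Odd (Nat.card (ClassGroup (𝓞 F))))
    {T : Finset (Ideal (𝓞 L))}
    (hT : ∀ P : Ideal (𝓞 L), P.IsPrime → P ≠ ⊥ → σ ∈ P.inertia Gal(L/F) → P ∈ T) :
    (unitsTwist hσ).range.index ≠ 0 ∧ (unitsTwist hσ).range.index ≤ 2 ^ T.card ∧
    ((unitsTwist hσ).range.index = 2 ^ T.card → ∀ v : T → ZMod 2, ∃ b : 𝓞 L, b ≠ 0 ∧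
      σ • Ideal.span {b} = Ideal.span {b} ∧
        ∀ P, (idealOrd P.1 (Ideal.span {b}) : ZMod 2) = v P) := by
  have h90 (u : (unitsNorm F L).ker) : ∃ b : 𝓞 L, b ≠ 0 ∧ (u.1 : L) * σ (b : L) = b :=
    exists_integral_of_mul_gal_eq_one hσ ((mem_ker_unitsNorm_iff hσ).1 u.2)
  choose β hβ0 hβ using h90
  let g (x : (unitsNorm F L).ker ⧸ (unitsTwist hσ).range) (P : T) : ZMod 2 :=
    idealOrd P.1 (Ideal.span {β x.out})
  have hg : Function.Injective g := by
    intro x y hxy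
    have hmem : x.out * y.out ∈ (unitsTwist hσ).range := by
      refine mem_range_unitsTwist_of_even hσ hF (mul_ne_zero (hβ0 x.out) (hβ0 y.out)) ?_ ?_
      · have h1 := hβ x.out
        have h2 := hβ y.out
        simp only [Subgroup.coe_mul, Units.val_mul, map_mul]
        linear_combination h1 * ((y.out.1 : L) * σ (β y.out)) + (β x.out : L) * h2
      · intro P hP hP0 hin
        rw [← Ideal.span_singleton_mul_span_singleton, idealOrd_mul _ (by simpa using hβ0 _)
          (by simpa using hβ0 _), ← ZMod.natCast_eq_zero_iff_even, Nat.cast_add]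
        have := congrFun hxy ⟨P, hT P hP hP0 hin⟩
        simp only [g] at this
        rw [this, CharTwo.add_self_eq_zero]
    have hsq : y.out ^ 2 ∈ (unitsTwist hσ).range := ⟨y.out.1, unitsTwist_coe_ker hσ _⟩
    rw [← Quotient.out_eq x, ← Quotient.out_eq y]
    refine QuotientGroup.eq.2 ?_
    rw [← Subgroup.inv_mem_iff, ← Subgroup.mul_mem_cancel_right _ hsq]
    convert hmem using 1
    rw [mul_inv, inv_inv, sq, mul_assoc, inv_mul_cancel_left]
  have hfin := Finite.of_injective g hg
  have hcard : Nat.card (T → ZMod 2) = 2 ^ T.card := by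
    rw [Nat.card_fun, Nat.card_zmod]; simp
  refine ⟨Nat.card_pos.ne', hcard ▸ Nat.card_le_card_of_injective g hg, fun h v => ?_⟩
  have hbij := (Nat.bijective_iff_injective_and_card g).2 ⟨hg, h.trans hcard.symm⟩
  obtain ⟨x, rfl⟩ := hbij.2 v
  exact ⟨β x.out, hβ0 _, span_smul_eq_of_mul_gal_eq (hβ _), fun P => rfl⟩

theorem isPrincipal_of_smul_eq (hσ : σ ≠ 1) (hF : Odd (Nat.card (ClassGroup (𝓞 F))))
    (hv : ∀ v : Ideal (𝓞 L) → ZMod 2, ∃ b : 𝓞 L, b ≠ 0 ∧ σ • Ideal.span {b} = Ideal.span {b} ∧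
      ∀ P : Ideal (𝓞 L), P.IsPrime → P ≠ ⊥ → σ ∈ P.inertia Gal(L/F) →
        (idealOrd P (Ideal.span {b}) : ZMod 2) = v P)
    {I : Ideal (𝓞 L)} (hI : I ≠ ⊥) (h2 : (I ^ 2).IsPrincipal) (hinv : σ • I = I) :
    I.IsPrincipal := by
  obtain ⟨b, hb0, hb, hbv⟩ := hv fun P => idealOrd P I
  have hb0' : Ideal.span {b} ≠ ⊥ := by simpa using hb0
  obtain ⟨J, hJ⟩ := exists_map_eq_of_smul_eq hσ (I * Ideal.span {b}) (mul_ne_zero hI hb0')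
    (by rw [smul_mul', hb, hinv]) fun P hP hP0 hin => by
      rw [idealOrd_mul _ hI hb0', ← ZMod.natCast_eq_zero_iff_even, Nat.cast_add,
        hbv P hP hP0 hin, CharTwo.add_self_eq_zero]
  refine Ideal.isPrincipal_of_sq_of_odd_pow hI h2 hF ?_
  refine Ideal.isPrincipal_of_mul_isPrincipal (b := b ^ Nat.card (ClassGroup (𝓞 F)))
    (pow_ne_zero _ hb0) ?_
  rw [← Ideal.span_singleton_pow, ← mul_pow, ← hJ, ← Ideal.map_pow]
  exact (J.isPrincipal_pow_card_classGroup).map_ringHom _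

theorem odd_card_classGroup_of_norm (hσ : σ ≠ 1) (hF : Odd (Nat.card (ClassGroup (𝓞 F))))
    (hv : ∀ v : Ideal (𝓞 L) → ZMod 2, ∃ b : 𝓞 L, b ≠ 0 ∧ σ • Ideal.span {b} = Ideal.span {b} ∧
      ∀ P : Ideal (𝓞 L), P.IsPrime → P ≠ ⊥ → σ ∈ P.inertia Gal(L/F) →
        (idealOrd P (Ideal.span {b}) : ZMod 2) = v P)
    (hN : ∀ u : (𝓞 F)ˣ, (∃ x : L, Algebra.norm F x = (u : F)) → u ∈ (unitsNorm F L).range) :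
    Odd (Nat.card (ClassGroup (𝓞 L))) := by
  rw [← Nat.not_even_iff_odd]
  intro heven
  obtain ⟨I, hI, hI2, hIp⟩ := exists_sq_isPrincipal_of_even_card_classGroup heven
  have hsmul0 (K : Ideal (𝓞 L)) (hK : K ≠ ⊥) : σ • K ≠ ⊥ := fun h => hK <| by
    rw [← inv_smul_smul σ K, h, Ideal.pointwise_smul_def, Ideal.map_bot]
  have hσσ : σ * σ = 1 := AlgEquiv.ext fun x => gal_apply_apply hσ x
  have hsmul (K : Ideal (𝓞 L)) : σ • σ • K = K := by rw [smul_smul, hσσ, one_smul]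
  obtain ⟨J, hJ⟩ := exists_map_eq_of_smul_eq hσ (I * σ • I) (mul_ne_zero hI (hsmul0 I hI))
    (by rw [smul_mul', hsmul, mul_comm]) fun P hP hP0 hin => by
      have hσP : σ • P = P := Ideal.inertia_le_stabilizer P hin
      have := idealOrd_smul σ hP0 hI
      rw [hσP] at this
      rw [idealOrd_mul _ hI (hsmul0 I hI), this]
      exact ⟨_, rfl⟩
  obtain ⟨f, hf⟩ := J.isPrincipal_pow_card_classGroup
  rw [Ideal.submodule_span_eq] at hf
  set n := Nat.card (ClassGroup (𝓞 F))
  have hf' : I ^ n * σ • I ^ n = Ideal.span {algebraMap (𝓞 F) (𝓞 L) f} := by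
    rw [smul_pow', ← mul_pow, ← hJ, ← Ideal.map_pow, hf, Ideal.map_span, Set.image_singleton]
  have hK2 : ((I ^ n) ^ 2).IsPrincipal := by
    rw [pow_right_comm]
    obtain ⟨a, ha⟩ := hI2
    rw [ha, Ideal.submodule_span_eq, Ideal.span_singleton_pow]
    exact ⟨_, rfl⟩
  have hKp : ¬ (I ^ n).IsPrincipal := fun h => hIp (Ideal.isPrincipal_of_sq_of_odd_pow hI hI2 hF h)
  have hK : I ^ n ≠ ⊥ := pow_ne_zero n hI
  generalize I ^ n = K at hf' hK2 hKp hK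
  obtain ⟨a, ha⟩ := hK2
  rw [Ideal.submodule_span_eq] at ha
  have hspan (x : 𝓞 L) : σ • Ideal.span {x} = Ideal.span {σ • x} := by
    rw [Ideal.pointwise_smul_def, Ideal.map_span, Set.image_singleton]; rfl
  have ha2 : Ideal.span {algebraMap (𝓞 F) (𝓞 L) f ^ 2} = Ideal.span {a * (σ • a)} := by
    rw [← Ideal.span_singleton_pow, ← hf', mul_pow, ← smul_pow', ha, hspan,
      Ideal.span_singleton_mul_span_singleton]
  obtain ⟨u, hu⟩ := Ideal.span_singleton_eq_span_singleton.1 ha2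
  have hu' : algebraMap F L f ^ 2 * (u : L) = (a : L) * σ (a : L) :=
    congrArg (algebraMap (𝓞 L) L) hu
  have ha0 : (a : L) ≠ 0 := by
    intro h
    have : a = 0 := RingOfIntegers.ext h
    rw [this, Ideal.span_singleton_eq_bot.2 rfl] at ha
    exact pow_ne_zero 2 hK ha
  have hf0 : algebraMap F L f ≠ 0 := by
    intro h
    rw [h, zero_pow two_ne_zero, zero_mul, zero_eq_mul] at hu'
    exact hu'.elim ha0 fun h' => ha0 (by simpa using h')
  obtain ⟨v, hv'⟩ := exists_units_map_eq_of_gal_fixed hσ (u := u) (by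
    have := congrArg σ hu'
    rw [map_mul, map_mul, map_pow, AlgEquiv.commutes, gal_apply_apply hσ, mul_comm (σ (a : L)),
      ← hu'] at this
    exact mul_left_cancel₀ (pow_ne_zero 2 hf0) this)
  obtain ⟨ε, hε⟩ := hN v ⟨a / algebraMap F L f, by
    apply (algebraMap F L).injective
    rw [algebraMap_norm_quadratic hσ, hv', map_div₀, AlgEquiv.commutes]
    field_simp
    rw [← hu', mul_comm]⟩
  have hε' := algebraMap_unitsNorm hσ ε
  rw [hε, hv'] at hε'
  have hε0 : (ε : L) ≠ 0 := Units.coe_ne_zero ε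
  have hσε0 : σ (ε : L) ≠ 0 := by simp [hε0]
  obtain ⟨b, hb0, hb⟩ := exists_integral_of_mul_gal_eq_one hσ
    (x := (a : L) / (algebraMap F L f * ε)) (by
    rw [map_div₀, map_mul, AlgEquiv.commutes]
    field_simp
    rw [← hu', hε']; ring)
  have hb' : a * (σ • b) = algebraMap (𝓞 F) (𝓞 L) f * b * ε := by
    apply RingOfIntegers.ext
    change (a : L) * σ (b : L) = algebraMap F L f * b * ε
    field_simp at hb
    rw [hb]; ring
  have hσb0 : σ • b ≠ 0 := by simp [smul_eq_zero_iff_eq, hb0]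
  have hspanb : Ideal.span {σ • b} ≠ ⊥ := by simp [hσb0]
  have hprin := isPrincipal_of_smul_eq hσ hF hv (I := K * Ideal.span {σ • b})
    (mul_ne_zero hK hspanb) (by
      rw [mul_pow, ha, Ideal.span_singleton_pow, Ideal.span_singleton_mul_span_singleton]
      exact ⟨_, rfl⟩) (by
      apply mul_left_cancel₀ hK
      rw [smul_mul', hspan, smul_smul, hσσ, one_smul, ← mul_assoc, hf', ← mul_assoc, ← sq, ha,
        Ideal.span_singleton_mul_span_singleton, Ideal.span_singleton_mul_span_singleton, hb']
      exact Ideal.span_singleton_eq_span_singleton.2 ⟨ε, rfl⟩)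
  exact hKp (Ideal.isPrincipal_of_mul_isPrincipal hσb0 hprin)

/-- A genus theory criterion for the parity of the class number. -/
theorem odd_card_classGroup [IsTotallyReal F] [IsTotallyReal L] (hσ : σ ≠ 1)
    (hF : Odd (Nat.card (ClassGroup (𝓞 F)))) {T : Finset (Ideal (𝓞 L))}
    (hT : ∀ P : Ideal (𝓞 L), P.IsPrime → P ≠ ⊥ → σ ∈ P.inertia Gal(L/F) → P ∈ T)
    (S : Subgroup (𝓞 F)ˣ) (hS : ∀ u, u ∈ S ↔ ∃ x : L, Algebra.norm F x = (u : F))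
    (hTS : 2 ^ T.card ≤ 2 * S.index) :
    Odd (Nat.card (ClassGroup (𝓞 L))) := by
  obtain ⟨h0, h1, h2⟩ := index_range_unitsTwist_le hσ hF hT
  rw [index_range_unitsTwist hσ] at h0 h1 h2
  have hle : (unitsNorm F L).range ≤ S := by
    rintro _ ⟨u, rfl⟩
    exact (hS _).2 ⟨u, rfl⟩
  have h3 := Subgroup.relIndex_mul_index hle
  have hS0 : S.index ≠ 0 := by
    intro h
    rw [h, mul_zero] at h3
    lia
  have h4 : (unitsNorm F L).range.relIndex S = 1 := by
    have : (unitsNorm F L).range.relIndex S * S.index ≤ 1 * S.index := by lia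
    have := Nat.le_of_mul_le_mul_right this (Nat.pos_of_ne_zero hS0)
    have h5 : (unitsNorm F L).range.relIndex S ≠ 0 := by
      intro h
      rw [h, zero_mul] at h3
      lia
    lia
  have hindex : 2 * (unitsNorm F L).range.index = 2 ^ T.card := by
    rw [h4, one_mul] at h3
    lia
  refine odd_card_classGroup_of_norm hσ hF (fun v => ?_) fun u hu =>
    Subgroup.relIndex_eq_one.1 h4 ((hS u).2 hu)
  obtain ⟨b, hb0, hb, hbv⟩ := h2 hindex fun P => v P
  exact ⟨b, hb0, hb, fun P hP hP0 hin => hbv ⟨P, hT P hP hP0 hin⟩⟩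

end Quadratic

section Counting

variable {L : Type*} [Field L] [NumberField L]

theorem absNorm_span_natCast (m : ℕ) :
    Ideal.absNorm (Ideal.span {(m : 𝓞 L)}) = m ^ finrank ℚ L := by
  have : (m : 𝓞 L) = algebraMap ℤ (𝓞 L) m := by simp
  rw [Ideal.absNorm_span_singleton, this, Algebra.norm_algebraMap, RingOfIntegers.rank,
    Int.natAbs_pow, Int.natAbs_natCast]

theorem mul_card_le_finrank_of_pow_dvd {m a f : ℕ} (hm : 1 < m) {S : Finset (Ideal (𝓞 L))}
    (hS : ∀ P ∈ S, P.IsPrime ∧ P ≠ ⊥ ∧ P ^ a ∣ Ideal.span {(m : 𝓞 L)} ∧ m ^ f ≤ P.absNorm) :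
    a * f * S.card ≤ finrank ℚ L := by
  have h1 : ∏ P ∈ S, P ^ a ∣ Ideal.span {(m : 𝓞 L)} := by
    refine Finset.prod_dvd_of_coprime (fun P hP Q hQ hne => ?_) fun P hP => (hS P hP).2.2.1
    have hPm := (hS P hP).1.isMaximal (hS P hP).2.1
    have hQm := (hS Q hQ).1.isMaximal (hS Q hQ).2.1
    exact IsCoprime.pow (Ideal.isCoprime_iff_sup_eq.2 (hPm.coprime_of_ne hQm hne))
  have h2 := Ideal.absNorm_dvd_absNorm_of_le (Ideal.le_of_dvd h1)
  have h4 : (m ^ (a * f)) ^ S.card ≤ Ideal.absNorm (∏ P ∈ S, P ^ a) := by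
    rw [map_prod]
    refine Finset.pow_card_le_prod _ _ _ fun P hP => ?_
    rw [map_pow, mul_comm, pow_mul]
    exact Nat.pow_le_pow_left (hS P hP).2.2.2 a
  rw [absNorm_span_natCast] at h2
  have h5 := h4.trans (Nat.le_of_dvd (by positivity) h2)
  rw [← pow_mul] at h5
  exact (Nat.pow_le_pow_iff_right hm).1 h5

theorem exists_absNorm_eq_pow {m : ℕ} (hm : m.Prime) {P : Ideal (𝓞 L)} (hP : P ≠ ⊤)
    (h : (m : 𝓞 L) ∈ P) : ∃ k, 1 ≤ k ∧ P.absNorm = m ^ k := by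
  have h1 := Ideal.absNorm_dvd_absNorm_of_le ((Ideal.span_singleton_le_iff_mem _).2 h)
  rw [absNorm_span_natCast] at h1
  obtain ⟨k, -, hk⟩ := (Nat.dvd_prime_pow hm).1 h1
  refine ⟨k, Nat.one_le_iff_ne_zero.2 ?_, hk⟩
  rintro rfl
  exact hP (Ideal.absNorm_eq_one_iff.1 (by simpa using hk))

theorem le_absNorm_of_mem {m : ℕ} (hm : m.Prime) {P : Ideal (𝓞 L)} (hP : P ≠ ⊤)
    (h : (m : 𝓞 L) ∈ P) : m ^ 1 ≤ P.absNorm := by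
  obtain ⟨k, hk, hP⟩ := exists_absNorm_eq_pow hm hP h
  exact hP ▸ Nat.pow_le_pow_right hm.pos hk

theorem sq_le_absNorm_of_mem {m : ℕ} (hm : m.Prime) {P : Ideal (𝓞 L)} (hP : P.IsMaximal)
    (h : (m : 𝓞 L) ∈ P) {x : 𝓞 L} (hx : x ^ m - x ∉ P) : m ^ 2 ≤ P.absNorm := by
  obtain ⟨k, hk, hPk⟩ := exists_absNorm_eq_pow hm hP.ne_top h
  have hk1 : k ≠ 1 := by
    rintro rfl
    let := Ideal.Quotient.field P
    rw [pow_one, Ideal.absNorm_apply, Submodule.cardQuot_apply] at hPk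
    have : Finite (𝓞 L ⧸ P) := Nat.finite_of_card_ne_zero (hPk ▸ hm.ne_zero)
    have := Fintype.ofFinite (𝓞 L ⧸ P)
    have h2 := FiniteField.pow_card (Ideal.Quotient.mk P x)
    rw [← Nat.card_eq_fintype_card, hPk, ← map_pow] at h2
    exact hx (Ideal.Quotient.eq.1 h2)
  exact hPk ▸ Nat.pow_le_pow_right hm.pos (by lia)

end Counting

section Quadratic

variable {F L : Type*} [Field F] [NumberField F] [Field L] [NumberField L] [Algebra F L]
  [Algebra.IsQuadraticExtension F L] {σ : Gal(L/F)}

theorem map_dvd_of_mem_inertia (hσ : σ ≠ 1) {P : Ideal (𝓞 L)} [hP : P.IsPrime] (h0 : P ≠ ⊥)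
    (h : σ ∈ P.inertia Gal(L/F)) {x : 𝓞 F} (hx : algebraMap (𝓞 F) (𝓞 L) x ∈ P) :
    P ^ 2 ∣ Ideal.span {algebraMap (𝓞 F) (𝓞 L) x} := by
  have hu : P.under (𝓞 F) ≠ ⊥ := mt Ideal.eq_bot_of_comap_eq_bot h0
  have h1 : P ^ 2 ∣ (P.under (𝓞 F)).map (algebraMap (𝓞 F) (𝓞 L)) := by
    rw [pow_dvd_iff_le_idealOrd h0 (Ideal.map_ne_bot_of_ne_bot hu),
      idealOrd_map_under_of_mem_inertia hσ h0 h]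
  refine h1.trans (Ideal.dvd_iff_le.2 ?_)
  rw [Ideal.span_singleton_le_iff_mem]
  exact Ideal.mem_map_of_mem _ hx

omit [NumberField F] [Algebra.IsQuadraticExtension F L] in
theorem exists_finset_mem_inertia {m : ℕ} (hm : 1 < m) (a f : ℕ)
    (h : ∀ P : Ideal (𝓞 L), P.IsPrime → P ≠ ⊥ → σ ∈ P.inertia Gal(L/F) → (m : 𝓞 L) ∈ P →
      P ^ a ∣ Ideal.span {(m : 𝓞 L)} ∧ m ^ f ≤ P.absNorm) :
    ∃ T : Finset (Ideal (𝓞 L)), (∀ P : Ideal (𝓞 L), P.IsPrime → P ≠ ⊥ → σ ∈ P.inertia Gal(L/F) →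
      (m : 𝓞 L) ∈ P → P ∈ T) ∧ a * f * T.card ≤ finrank ℚ L := by
  classical
  have hm0 : Ideal.span {(m : 𝓞 L)} ≠ ⊥ := by
    simp only [ne_eq, Ideal.span_singleton_eq_bot, Nat.cast_eq_zero]; lia
  refine ⟨(UniqueFactorizationMonoid.normalizedFactors (Ideal.span {(m : 𝓞 L)})).toFinset.filter
    fun P => P.IsPrime ∧ σ ∈ P.inertia Gal(L/F), fun P hP hP0 hin hmP => ?_, ?_⟩
  · rw [Finset.mem_filter, Multiset.mem_toFinset, Ideal.mem_normalizedFactors_iff hm0,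
      Ideal.span_singleton_le_iff_mem]
    exact ⟨⟨hP, hmP⟩, hP, hin⟩
  · refine mul_card_le_finrank_of_pow_dvd hm fun P hP => ?_
    rw [Finset.mem_filter, Multiset.mem_toFinset, Ideal.mem_normalizedFactors_iff hm0,
      Ideal.span_singleton_le_iff_mem] at hP
    obtain ⟨⟨hP, hmP⟩, -, hin⟩ := hP
    have hP0 : P ≠ ⊥ := by
      rintro rfl
      exact hm0 (by simpa using hmP)
    exact ⟨hP, hP0, h P hP hP0 hin hmP⟩

variable (F L) in
/-- The units of `F` that are norms of elements of `L`. -/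
noncomputable def normUnits : Subgroup (𝓞 F)ˣ where
  carrier := {u | ∃ x : L, Algebra.norm F x = (u : F)}
  mul_mem' := by
    rintro u v ⟨x, hx⟩ ⟨y, hy⟩
    exact ⟨x * y, by rw [map_mul, hx, hy]; simp⟩
  one_mem' := ⟨1, by simp⟩
  inv_mem' := by
    rintro u ⟨x, hx⟩
    refine ⟨x⁻¹, ?_⟩
    have : (u : F) * ((u⁻¹ : (𝓞 F)ˣ) : F) = 1 := by
      rw [← Units.coe_mul, mul_inv_cancel, Units.coe_one]
    have h0 : Algebra.norm F x ≠ 0 := hx ▸ Units.coe_ne_zero u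
    rw [← hx] at this
    apply mul_left_cancel₀ h0
    rw [this, ← map_mul, mul_inv_cancel₀, map_one]
    rintro rfl
    simp at h0

theorem mem_normUnits {u : (𝓞 F)ˣ} : u ∈ normUnits F L ↔ ∃ x : L, Algebra.norm F x = (u : F) :=
  Iff.rfl

theorem index_normUnits_ne_zero [IsTotallyReal F] : (normUnits F L).index ≠ 0 := by
  have h := index_range_sq_units F
  have hle : (powMonoidHom 2 : (𝓞 F)ˣ →* _).range ≤ normUnits F L := by
    rintro _ ⟨u, rfl⟩
    refine ⟨algebraMap F L u, ?_⟩
    rw [Algebra.norm_algebraMap, Algebra.IsQuadraticExtension.finrank_eq_two F L]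
    simp
  intro h0
  have := Subgroup.relIndex_mul_index hle
  rw [h0, h, mul_zero] at this
  exact pow_ne_zero _ two_ne_zero this.symm

theorem odd_card_classGroup_of_card_le_one [IsTotallyReal F] [IsTotallyReal L] (hσ : σ ≠ 1)
    (hF : Odd (Nat.card (ClassGroup (𝓞 F)))) {T : Finset (Ideal (𝓞 L))}
    (hT : ∀ P : Ideal (𝓞 L), P.IsPrime → P ≠ ⊥ → σ ∈ P.inertia Gal(L/F) → P ∈ T)
    (hcard : T.card ≤ 1) : Odd (Nat.card (ClassGroup (𝓞 L))) := by
  refine odd_card_classGroup hσ hF hT (normUnits F L) (fun u => mem_normUnits) ?_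
  have := index_normUnits_ne_zero (F := F) (L := L)
  calc 2 ^ T.card ≤ 2 ^ 1 := Nat.pow_le_pow_right two_pos hcard
    _ ≤ _ := by lia

theorem odd_card_classGroup_of_card_le_two [IsTotallyReal F] [IsTotallyReal L] (hσ : σ ≠ 1)
    (hF : Odd (Nat.card (ClassGroup (𝓞 F)))) {T : Finset (Ideal (𝓞 L))}
    (hT : ∀ P : Ideal (𝓞 L), P.IsPrime → P ≠ ⊥ → σ ∈ P.inertia Gal(L/F) → P ∈ T)
    (hcard : T.card ≤ 2) (u : (𝓞 F)ˣ) (hu : ∀ x : L, Algebra.norm F x ≠ (u : F)) :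
    Odd (Nat.card (ClassGroup (𝓞 L))) := by
  refine odd_card_classGroup hσ hF hT (normUnits F L) (fun u => mem_normUnits) ?_
  have h0 := index_normUnits_ne_zero (F := F) (L := L)
  have h1 : (normUnits F L).index ≠ 1 := fun h => by
    obtain ⟨x, hx⟩ := mem_normUnits.1 (Subgroup.index_eq_one.1 h ▸ Subgroup.mem_top u)
    exact hu x hx
  calc 2 ^ T.card ≤ 2 ^ 2 := Nat.pow_le_pow_right two_pos hcard
    _ ≤ _ := by lia

end Quadratic

section SquareRoot

variable {F L : Type*} [Field F] [NumberField F] [Field L] [NumberField L] [Algebra F L]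
  [Algebra.IsQuadraticExtension F L] {σ : Gal(L/F)} {s : L} {d : F}

theorem exists_gal_apply_eq_neg (hs : s ^ 2 = algebraMap F L d) (hd : ¬IsSquare d) :
    ∃ σ : Gal(L/F), σ ≠ 1 ∧ σ s = -s := by
  have h : Nat.card Gal(L/F) = 2 := by
    rw [IsGaloisGroup.card_eq_finrank Gal(L/F) F L, Algebra.IsQuadraticExtension.finrank_eq_two]
  have : Finite Gal(L/F) := Nat.finite_of_card_ne_zero (by lia)
  have : Nontrivial Gal(L/F) := Finite.one_lt_card_iff_nontrivial.1 (by lia)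
  obtain ⟨σ, hσ⟩ := exists_ne (1 : Gal(L/F))
  refine ⟨σ, hσ, ?_⟩
  have h2 : σ s ^ 2 = s ^ 2 := by rw [← map_pow, hs, AlgEquiv.commutes]
  rcases sq_eq_sq_iff_eq_or_eq_neg.1 h2 with h3 | h3
  · obtain ⟨y, rfl⟩ := exists_algebraMap_eq_of_gal_fixed hσ h3
    rw [← map_pow] at hs
    exact absurd ⟨y, by rw [← sq]; exact ((algebraMap F L).injective hs).symm⟩ hd
  · exact h3

theorem exists_eq_add_mul (hσ : σ ≠ 1) (hs0 : s ≠ 0) (hσs : σ s = -s) (x : L) :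
    ∃ a b : F, x = algebraMap F L a + algebraMap F L b * s := by
  obtain ⟨a, ha⟩ := exists_algebraMap_eq_of_gal_fixed hσ (x := (x + σ x) / 2) (by
    rw [map_div₀, map_add, gal_apply_apply hσ, add_comm, map_ofNat])
  obtain ⟨b, hb⟩ := exists_algebraMap_eq_of_gal_fixed hσ (x := (x - σ x) / (2 * s)) (by
    simp only [map_div₀, map_sub, gal_apply_apply hσ, map_mul, hσs, map_ofNat]
    field_simp
    ring)
  refine ⟨a, b, ?_⟩
  rw [ha, hb]
  field_simp
  ring

theorem norm_add_mul_of_gal_apply_eq_neg (hσ : σ ≠ 1) (hs : s ^ 2 = algebraMap F L d)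
    (hσs : σ s = -s) (a b : F) :
    Algebra.norm F (algebraMap F L a + algebraMap F L b * s) = a ^ 2 - d * b ^ 2 := by
  apply (algebraMap F L).injective
  rw [algebraMap_norm_quadratic hσ]
  simp only [map_add, map_mul, hσs, AlgEquiv.commutes, map_sub, map_pow, ← hs]
  ring

theorem exists_norm_eq_sq_sub (hs : s ^ 2 = algebraMap F L d) (hd : ¬IsSquare d) (x : L) :
    ∃ a b : F, Algebra.norm F x = a ^ 2 - d * b ^ 2 := by
  obtain ⟨σ, hσ, hσs⟩ := exists_gal_apply_eq_neg hs hd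
  have hs0 : s ≠ 0 := by
    rintro rfl
    have : d = 0 := (algebraMap F L).injective (by rw [← hs]; simp)
    exact hd (this ▸ IsSquare.zero)
  obtain ⟨a, b, rfl⟩ := exists_eq_add_mul hσ hs0 hσs x
  exact ⟨a, b, norm_add_mul_of_gal_apply_eq_neg hσ hs hσs a b⟩

theorem isSquare_or_isSquare_mul (hs : s ^ 2 = algebraMap F L d) (hd : ¬IsSquare d) {m : F}
    (hm : IsSquare (algebraMap F L m)) : IsSquare m ∨ IsSquare (m * d) := by
  obtain ⟨σ, hσ, hσs⟩ := exists_gal_apply_eq_neg hs hd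
  obtain ⟨x, hx⟩ := hm
  have h2 : σ x ^ 2 = x ^ 2 := by rw [← map_pow, sq x, ← hx, AlgEquiv.commutes]
  rcases sq_eq_sq_iff_eq_or_eq_neg.1 h2 with h3 | h3
  · obtain ⟨y, rfl⟩ := exists_algebraMap_eq_of_gal_fixed hσ h3
    rw [← map_mul] at hx
    exact .inl ⟨y, (algebraMap F L).injective hx⟩
  · obtain ⟨y, hy⟩ := exists_algebraMap_eq_of_gal_fixed hσ (x := x * s) (by simp [h3, hσs])
    refine .inr ⟨y, (algebraMap F L).injective ?_⟩
    rw [map_mul, map_mul, hx, ← hs, hy]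
    ring

theorem isTotallyReal_of_sq_eq_natCast [IsTotallyReal F] {m : ℕ} (hs : s ^ 2 = (m : L))
    (hm : ¬IsSquare (m : F)) : IsTotallyReal L where
  isReal v := by
    obtain ⟨σ, hσ, hσs⟩ := exists_gal_apply_eq_neg (d := (m : F)) (by simpa using hs) hm
    have hs0 : s ≠ 0 := by
      rintro rfl
      have : m = 0 := by
        have : (m : L) = 0 := by rw [← hs]; simp
        exact_mod_cast this
      exact hm (by simp [this])
    rw [InfinitePlace.isReal_iff]
    set φ := v.embedding
    have hφs : starRingEnd ℂ (φ s) = φ s := by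
      have h1 : (φ s) ^ 2 = ((√m : ℝ) : ℂ) ^ 2 := by
        rw [← map_pow, hs, map_natCast, ← Complex.ofReal_pow, Real.sq_sqrt (by positivity)]
        simp
      rcases sq_eq_sq_iff_eq_or_eq_neg.1 h1 with h | h <;> simp [h]
    have hφF (a : F) : starRingEnd ℂ (φ (algebraMap F L a)) = φ (algebraMap F L a) :=
      RingHom.congr_fun (IsTotallyReal.complexEmbedding_isReal (φ.comp (algebraMap F L))) a
    rw [ComplexEmbedding.isReal_iff]
    ext x
    obtain ⟨a, b, rfl⟩ := exists_eq_add_mul hσ hs0 hσs x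
    simp [ComplexEmbedding.conjugate_coe_eq, hφs, hφF]

end SquareRoot

section Padic

variable {r : ℕ} [Fact r.Prime]

theorem isSquare_padicInt_of_legendreSym_eq_one (hr : r ≠ 2) {m : ℤ} (hm : legendreSym r m = 1) :
    IsSquare (m : ℤ_[r]) := by
  have hm0 : ((m : ℤ) : ZMod r) ≠ 0 := fun h => by
    rw [(legendreSym.eq_zero_iff r m).2 h] at hm
    exact zero_ne_one hm
  obtain ⟨a, ha⟩ := (legendreSym.eq_one_iff r hm0).1 hm
  have hcast (k : ℤ) : PadicInt.toZMod (k : ℤ_[r]) = (k : ZMod r) := map_intCast _ _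
  have hnorm (z : ℤ_[r]) : ‖z‖ < 1 ↔ PadicInt.toZMod z = 0 := by
    rw [← PadicInt.mem_nonunits, ← IsLocalRing.mem_maximalIdeal, ← PadicInt.ker_toZMod,
      RingHom.mem_ker]
  obtain ⟨k, rfl⟩ := ZMod.intCast_surjective a
  have h1 : ‖((k : ℤ_[r]) ^ 2 - m)‖ < 1 := by
    rw [hnorm]
    simp [ha, sq]
  have h2 : ‖(2 * k : ℤ_[r])‖ = 1 := by
    refine le_antisymm (PadicInt.norm_le_one _) (not_lt.1 fun h => ?_)
    rw [hnorm, map_mul, hcast, map_ofNat, mul_eq_zero] at h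
    rcases h with h | h
    · have := (ZMod.natCast_eq_zero_iff 2 r).1 (by exact_mod_cast h)
      exact hr ((Nat.prime_dvd_prime_iff_eq Fact.out Nat.prime_two).1 this)
    · exact hm0 (by rw [ha, h, zero_mul])
  obtain ⟨z, hz, -⟩ := hensels_lemma (p := r) (R := ℤ_[r])
    (F := Polynomial.X ^ 2 - Polynomial.C (m : ℤ_[r])) (a := (k : ℤ_[r])) (by
      simpa [one_add_one_eq_two, ← norm_mul, -norm_mul, h2] using h1)
  refine ⟨z, ?_⟩
  have : z ^ 2 - (m : ℤ_[r]) = 0 := by simpa using hz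
  rw [← sq, sub_eq_zero.1 this]

theorem sq_sub_prime_mul_sq_ne {m : ℤ} (hm : legendreSym r m = -1) (x y : ℚ_[r]) :
    x ^ 2 - r * y ^ 2 ≠ m := by
  intro h
  have hm0 : ((m : ℤ) : ZMod r) ≠ 0 := fun h => by
    rw [(legendreSym.eq_zero_iff r m).2 h] at hm
    simp at hm
  have hr0 : (r : ℚ_[r]) ≠ 0 := Nat.cast_ne_zero.2 (Fact.out : r.Prime).ne_zero
  have hmn : ‖(m : ℚ_[r])‖ ≤ 1 := Padic.norm_int_le_one m
  have hval : y ≠ 0 → (r * y ^ 2 : ℚ_[r]).valuation = 1 + 2 * y.valuation := fun hy => by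
    rw [Padic.valuation_mul hr0 (pow_ne_zero _ hy), Padic.valuation_p, Padic.valuation_pow]
    norm_cast
  have hx : ‖x‖ ≤ 1 := by
    by_contra! hx
    have hx2 : 1 < ‖x ^ 2‖ := by rw [norm_pow]; exact one_lt_pow₀ hx two_ne_zero
    have hx0 : x ≠ 0 := by
      rintro rfl
      norm_num at hx
    have heq : ‖(r * y ^ 2 : ℚ_[r])‖ = ‖x ^ 2‖ := by
      rw [show (r * y ^ 2 : ℚ_[r]) = x ^ 2 + -(m : ℚ_[r]) by rw [← h]; ring]
      rw [Padic.add_eq_max_of_ne, norm_neg, max_eq_left (hmn.trans hx2.le)]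
      rw [norm_neg]
      exact (hmn.trans_lt hx2).ne'
    have hy0 : y ≠ 0 := by
      rintro rfl
      simp at heq
      exact hx0 (by simpa using heq.symm)
    rw [Padic.norm_eq_zpow_neg_valuation (mul_ne_zero hr0 (pow_ne_zero _ hy0)),
      Padic.norm_eq_zpow_neg_valuation (pow_ne_zero _ hx0), hval hy0, Padic.valuation_pow] at heq
    have hr1 : (1 : ℝ) < r := by exact_mod_cast (Fact.out : r.Prime).one_lt
    have := zpow_right_injective₀ (by linarith) hr1.ne' heq
    push_cast at this
    lia
  have hy : ‖y‖ ≤ 1 := by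
    rcases eq_or_ne y 0 with rfl | hy0
    · simp
    have : ‖(r * y ^ 2 : ℚ_[r])‖ ≤ 1 := by
      rw [show (r * y ^ 2 : ℚ_[r]) = x ^ 2 + -(m : ℚ_[r]) by rw [← h]; ring]
      refine (Padic.nonarchimedean _ _).trans (max_le ?_ (by rwa [norm_neg]))
      rw [norm_pow]
      exact pow_le_one₀ (norm_nonneg _) hx
    rw [Padic.norm_le_one_iff_val_nonneg, hval hy0] at this
    rw [Padic.norm_le_one_iff_val_nonneg]
    lia
  obtain ⟨x, rfl⟩ : ∃ x' : ℤ_[r], (x' : ℚ_[r]) = x := ⟨⟨x, hx⟩, rfl⟩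
  obtain ⟨y, rfl⟩ : ∃ y' : ℤ_[r], (y' : ℚ_[r]) = y := ⟨⟨y, hy⟩, rfl⟩
  have h3 : x ^ 2 - r * y ^ 2 = (m : ℤ_[r]) := Subtype.ext (by push_cast; exact h)
  have h4 := congrArg (PadicInt.toZMod (p := r)) h3
  simp only [map_sub, map_pow, map_mul, map_natCast, map_intCast, CharP.cast_eq_zero, zero_mul,
    sub_zero] at h4
  exact (legendreSym.eq_neg_one_iff r).1 hm ⟨_, by rw [← h4, sq]⟩

end Padic

section Tower

variable {F L : Type*} [Field F] [NumberField F] [Field L] [NumberField L] [Algebra F L]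
  [Algebra.IsQuadraticExtension F L] {σ : Gal(L/F)}

variable (F L) in
theorem finrank_rat_of_isQuadraticExtension : finrank ℚ L = 2 * finrank ℚ F := by
  rw [← finrank_mul_finrank ℚ F L, Algebra.IsQuadraticExtension.finrank_eq_two F L, mul_comm]

omit [NumberField F] [NumberField L] [Algebra.IsQuadraticExtension F L] in
theorem two_mul_mem_of_mem_inertia {P : Ideal (𝓞 L)} (h : σ ∈ P.inertia Gal(L/F)) {s : 𝓞 L}
    (hs : σ (s : L) = -(s : L)) : 2 * s ∈ P := by
  have h1 : σ • s - s ∈ P := h s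
  have h2 : σ • s = -s := RingOfIntegers.ext (by
    rw [RingOfIntegers.coe_gal_smul, hs]
    rfl)
  rw [h2] at h1
  convert neg_mem h1 using 1
  ring

theorem exists_finset_natCast_mem_inertia (hσ : σ ≠ 1) {m : ℕ} (hm : m.Prime) :
    ∃ T : Finset (Ideal (𝓞 L)), (∀ P : Ideal (𝓞 L), P.IsPrime → P ≠ ⊥ → σ ∈ P.inertia Gal(L/F) →
      (m : 𝓞 L) ∈ P → P ∈ T) ∧ 2 * T.card ≤ finrank ℚ L := by
  refine exists_finset_mem_inertia hm.one_lt 2 1 fun P hP hP0 hin hmP => ⟨?_, ?_⟩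
  · have := map_dvd_of_mem_inertia hσ hP0 hin (x := (m : 𝓞 F)) (by simpa using hmP)
    simpa using this
  · exact le_absNorm_of_mem hm hP.ne_top hmP

theorem exists_sq_eq_two_mul_unit {q : ℕ} (hq : q % 4 = 3) {s : 𝓞 F} (hs : s ^ 2 = q)
    (hF : Odd (Nat.card (ClassGroup (𝓞 F)))) : ∃ (γ : 𝓞 F) (u : (𝓞 F)ˣ), γ ^ 2 = 2 * u := by
  obtain ⟨k, rfl⟩ : ∃ k, q = 4 * k + 3 := ⟨q / 4, by lia⟩
  push_cast at hs
  have hsq : Ideal.span {2, 1 + s} ^ 2 = Ideal.span {(2 : 𝓞 F)} := by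
    rw [sq, Ideal.span_pair_mul_span_pair]
    apply le_antisymm
    · rw [Ideal.span_le]
      rintro x (rfl | rfl | rfl | rfl) <;>
        rw [SetLike.mem_coe, Ideal.mem_span_singleton]
      · exact dvd_mul_right _ _
      · exact dvd_mul_right _ _
      · exact dvd_mul_left _ _
      · exact ⟨2 * k + 2 + s, by linear_combination hs⟩
    · rw [Ideal.span_singleton_le_iff_mem]
      have e : (2 : 𝓞 F) = (1 + s) * (1 + s) - 2 * (1 + s) - k * (2 * 2) := by
        linear_combination -hs
      rw [Ideal.mem_span_insert]
      refine ⟨-k, (1 + s) * (1 + s) - 2 * (1 + s), sub_mem ?_ ?_, by linear_combination e⟩ <;>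
        exact Ideal.subset_span (by simp)
  have h0 : Ideal.span {2, 1 + s} ≠ ⊥ := fun h => by
    rw [h, ← Ideal.zero_eq_bot, zero_pow two_ne_zero, eq_comm, Ideal.zero_eq_bot,
      Ideal.span_singleton_eq_bot] at hsq
    exact two_ne_zero hsq
  obtain ⟨γ, hγ⟩ := Ideal.isPrincipal_of_sq_of_odd_pow h0 (hsq ▸ ⟨2, rfl⟩) hF
    (Ideal.isPrincipal_pow_card_classGroup _)
  rw [Ideal.submodule_span_eq] at hγ
  rw [hγ, Ideal.span_singleton_pow, Ideal.span_singleton_eq_span_singleton] at hsq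
  obtain ⟨u, hu⟩ := hsq.symm
  exact ⟨γ, u, hu.symm⟩

theorem odd_card_classGroup_of_sq_eq_prime_of_rat [Algebra.IsQuadraticExtension ℚ L] {q : ℕ}
    [Fact q.Prime] (hq : q % 4 = 3) {s : 𝓞 L} (hs : s ^ 2 = q) :
    Odd (Nat.card (ClassGroup (𝓞 L))) := by
  classical
  have hqp : q.Prime := Fact.out
  have hleg : legendreSym q (-1) = -1 := by
    rw [legendreSym.at_neg_one (by rintro rfl; lia), ZMod.χ₄_nat_three_mod_four hq]
  have hd : ¬IsSquare (q : ℚ) := by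
    rw [Rat.isSquare_natCast_iff]
    exact hqp.prime.not_isSquare
  have hsL : (s : L) ^ 2 = (q : L) := by simpa using congrArg (algebraMap (𝓞 L) L) hs
  have hsL' : (s : L) ^ 2 = algebraMap ℚ L q := by simpa using hsL
  have : IsTotallyReal L := isTotallyReal_of_sq_eq_natCast (F := ℚ) hsL hd
  obtain ⟨σ, hσ, hσs⟩ := exists_gal_apply_eq_neg hsL' hd
  obtain ⟨T₁, hT₁, hc₁⟩ := exists_finset_natCast_mem_inertia hσ Nat.prime_two
  obtain ⟨T₂, hT₂, hc₂⟩ := exists_finset_natCast_mem_inertia hσ hqp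
  rw [finrank_rat_of_isQuadraticExtension ℚ L, finrank_self] at hc₁ hc₂
  refine odd_card_classGroup_of_card_le_two hσ ?_ (T := T₁ ∪ T₂) ?_
    ((Finset.card_union_le _ _).trans (by lia)) (-1) fun x hx => ?_
  · have h1 : Nat.card (ClassGroup (𝓞 ℚ)) = 1 := by
      rw [Nat.card_eq_fintype_card]
      exact Rat.classNumber_eq
    rw [h1]
    exact odd_one
  · intro P hP hP0 hin
    rw [Finset.mem_union]
    rcases hP.mem_or_mem (two_mul_mem_of_mem_inertia hin hσs) with h | h
    · exact .inl (hT₁ P hP hP0 hin (by simpa using h))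
    · exact .inr (hT₂ P hP hP0 hin (by rw [← hs]; exact Ideal.pow_mem_of_mem _ h 2 two_pos))
  · obtain ⟨a, b, hab⟩ := exists_norm_eq_sq_sub hsL' hd x
    rw [hx] at hab
    refine sq_sub_prime_mul_sq_ne hleg (a : ℚ_[q]) (b : ℚ_[q]) ?_
    have := congrArg (fun z : ℚ => (z : ℚ_[q])) hab
    push_cast at this
    simpa using this.symm

theorem exists_two_mul_eq_one_add {p : ℕ} (hp : p % 4 = 1) {s : 𝓞 F} (hs : s ^ 2 = p) :
    ∃ y : 𝓞 F, 2 * y = 1 + s := by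
  obtain ⟨k, rfl⟩ : ∃ k, p = 4 * k + 1 := ⟨p / 4, by lia⟩
  have hsF : (s : F) ^ 2 = 4 * k + 1 := by
    simpa [map_ofNat (algebraMap (𝓞 F) F) 4] using congrArg (algebraMap (𝓞 F) F) hs
  have hint : IsIntegral ℤ ((1 + (s : F)) / 2) := by
    refine ⟨Polynomial.X ^ 2 - (Polynomial.X + (k : Polynomial ℤ)), ?_, ?_⟩
    · monicity!
    · simp only [Polynomial.eval₂_sub, Polynomial.eval₂_pow, Polynomial.eval₂_X,
        Polynomial.eval₂_add, Polynomial.eval₂_natCast]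
      linear_combination hsF / 4
  obtain ⟨y, hy⟩ : ∃ y : 𝓞 F, algebraMap (𝓞 F) F y = (1 + algebraMap (𝓞 F) F s) / 2 :=
    ⟨⟨_, hint⟩, rfl⟩
  refine ⟨y, FaithfulSMul.algebraMap_injective (𝓞 F) F ?_⟩
  rw [map_add, map_one, map_mul, map_ofNat, hy]
  field_simp

theorem odd_card_classGroup_of_sq_eq_prime [IsTotallyReal F]
    (hF : Odd (Nat.card (ClassGroup (𝓞 F)))) {γ : 𝓞 F} {u : (𝓞 F)ˣ} (hγ : γ ^ 2 = 2 * u) {p : ℕ}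
    [Fact p.Prime] (hp : p % 8 = 5) (φ : F →+* ℚ_[p]) (hd : ¬IsSquare (p : F)) {s : 𝓞 L}
    (hs : s ^ 2 = p) (hL : finrank ℚ L ≤ 4) : Odd (Nat.card (ClassGroup (𝓞 L))) := by
  have hpp : p.Prime := Fact.out
  have hleg : legendreSym p 2 = -1 := by
    rw [legendreSym.at_two (by rintro rfl; lia), ZMod.χ₈_nat_eq_if_mod_eight]
    simp [hp, show p % 2 = 1 by lia]
  have hsL : (s : L) ^ 2 = (p : L) := by simpa using congrArg (algebraMap (𝓞 L) L) hs
  have hsL' : (s : L) ^ 2 = algebraMap F L p := by simpa using hsL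
  have : IsTotallyReal L := isTotallyReal_of_sq_eq_natCast (F := F) hsL hd
  obtain ⟨σ, hσ, hσs⟩ := exists_gal_apply_eq_neg hsL' hd
  obtain ⟨T, hT, hc⟩ := exists_finset_natCast_mem_inertia hσ hpp
  refine odd_card_classGroup_of_card_le_two hσ hF (T := T) ?_ (by lia) u fun x hx => ?_
  · intro P hP hP0 hin
    refine hT P hP hP0 hin ?_
    rw [← hs]
    refine Ideal.pow_mem_of_mem _ ?_ 2 two_pos
    obtain ⟨y, hy⟩ := exists_two_mul_eq_one_add (by lia) hs
    have h1 : σ • y - y ∈ P := hin y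
    have h2 : 2 * (σ • y - y) = 2 * -s := by
      have h3 : σ • s = -s := RingOfIntegers.ext (by
        rw [RingOfIntegers.coe_gal_smul, hσs]
        rfl)
      have h4 := congrArg (σ • ·) hy
      simp only [smul_mul', smul_add, smul_one, h3] at h4
      have h5 : σ • (2 : 𝓞 L) = 2 := by
        exact_mod_cast map_ofNat (MulSemiringAction.toRingHom Gal(L/F) (𝓞 L) σ) 2
      rw [h5] at h4
      linear_combination h4 - hy
    rw [mul_left_cancel₀ two_ne_zero h2] at h1
    simpa using h1
  · obtain ⟨a, b, hab⟩ := exists_norm_eq_sq_sub hsL' hd x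
    rw [hx] at hab
    have hγF : (γ : F) ^ 2 = 2 * (u : F) := by
      simpa [map_ofNat (algebraMap (𝓞 F) F) 2] using congrArg (algebraMap (𝓞 F) F) hγ
    have hu : (u : F) ≠ 0 := Units.coe_ne_zero u
    refine sq_sub_prime_mul_sq_ne hleg (φ (a * γ / u)) (φ (b * γ / u)) ?_
    rw [← map_natCast φ p, ← map_pow, ← map_pow, ← map_mul, ← map_sub, Int.cast_ofNat,
      ← map_ofNat φ 2]
    congr 1
    field_simp
    linear_combination (a ^ 2 - p * b ^ 2) * hγF - 2 * (u : F) * hab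

theorem odd_card_classGroup_of_sq_eq_two [IsTotallyReal F]
    (hF : Odd (Nat.card (ClassGroup (𝓞 F)))) {γ : 𝓞 F} {u : (𝓞 F)ˣ} (hγ : γ ^ 2 = 2 * u) {p : ℕ}
    (hp : p % 8 = 5) {t : 𝓞 F} (ht : t ^ 2 = p) (hd : ¬IsSquare (2 : F)) {s : 𝓞 L}
    (hs : s ^ 2 = 2) (hL : finrank ℚ L ≤ 8) : Odd (Nat.card (ClassGroup (𝓞 L))) := by
  have hsL : (s : L) ^ 2 = ((2 : ℕ) : L) := by
    simpa [map_ofNat (algebraMap (𝓞 L) L) 2] using congrArg (algebraMap (𝓞 L) L) hs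
  have hsL' : (s : L) ^ 2 = algebraMap F L 2 := by rw [hsL, map_ofNat, Nat.cast_ofNat]
  have : IsTotallyReal L := isTotallyReal_of_sq_eq_natCast (F := F) hsL (by simpa using hd)
  obtain ⟨σ, hσ, hσs⟩ := exists_gal_apply_eq_neg hsL' hd
  obtain ⟨y, hy⟩ := exists_two_mul_eq_one_add (by lia) ht
  obtain ⟨k, rfl⟩ : ∃ k, p = 8 * k + 5 := ⟨p / 8, by lia⟩
  obtain ⟨T, hT, hc⟩ := exists_finset_mem_inertia (σ := σ) one_lt_two 4 2 fun P hP hP0 hin h2 => by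
    have hP := hP.isMaximal hP0
    push_cast at h2
    constructor
    · have hγP : algebraMap (𝓞 F) (𝓞 L) γ ∈ P := by
        refine hP.isPrime.mem_of_pow_mem 2 ?_
        rw [← map_pow, hγ, map_mul, map_ofNat]
        exact Ideal.mul_mem_right _ _ h2
      have h := pow_dvd_pow_of_dvd (map_dvd_of_mem_inertia hσ hP0 hin hγP) 2
      rw [← pow_mul, Ideal.span_singleton_pow, ← map_pow, hγ, map_mul, map_ofNat] at h
      rwa [Nat.cast_ofNat, ← Ideal.span_singleton_mul_right_unit
        (u.isUnit.map (algebraMap (𝓞 F) (𝓞 L)))]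
    · refine sq_le_absNorm_of_mem Nat.prime_two hP h2 (x := algebraMap (𝓞 F) (𝓞 L) y) fun h => ?_
      have hy2 : y ^ 2 - y = 2 * k + 1 := by
        push_cast at ht
        refine mul_left_cancel₀ (show (4 : 𝓞 F) ≠ 0 by norm_num) ?_
        linear_combination (2 * y + t - 1) * hy + ht
      rw [← map_pow, ← map_sub, hy2] at h
      simp only [map_add, map_mul, map_ofNat, map_natCast, map_one] at h
      exact hP.ne_top ((Ideal.eq_top_iff_one _).2
        ((Ideal.add_mem_iff_right _ (Ideal.mul_mem_right _ _ h2)).1 h))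
  refine odd_card_classGroup_of_card_le_one hσ hF (T := T) ?_ (by lia)
  intro P hP hP0 hin
  refine hT P hP hP0 hin ?_
  rcases hP.mem_or_mem (two_mul_mem_of_mem_inertia hin hσs) with h | h
  · simpa using h
  · rw [Nat.cast_ofNat, ← hs]
    exact Ideal.pow_mem_of_mem _ h 2 two_pos

end Tower

section Adjoin

variable {F E : Type*} [Field F] [Field E] [Algebra F E]

theorem minpoly_eq_of_sq_eq {s : E} {d : F} (hs : s ^ 2 = algebraMap F E d) (hd : ¬IsSquare d) :
    minpoly F s = Polynomial.X ^ 2 - Polynomial.C d := by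
  refine (minpoly.eq_of_irreducible_of_monic ?_ (by simp [hs]) (by monicity!)).symm
  rw [X_pow_sub_C_irreducible_iff_of_prime Nat.prime_two]
  exact fun b hb => hd ⟨b, by rw [← hb, sq]⟩

theorem isIntegral_of_sq_eq {s : E} {d : F} (hs : s ^ 2 = algebraMap F E d) : IsIntegral F s :=
  IsIntegral.of_pow two_pos (hs ▸ isIntegral_algebraMap)

theorem isQuadraticExtension_adjoin_of_sq_eq {s : E} {d : F} (hs : s ^ 2 = algebraMap F E d)
    (hd : ¬IsSquare d) : Algebra.IsQuadraticExtension F F⟮s⟯ where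
  finrank_eq_two' := by
    rw [adjoin.finrank (isIntegral_of_sq_eq hs), minpoly_eq_of_sq_eq hs hd]
    compute_degree!

theorem nonempty_algHom_adjoin_of_sq_eq {K : Type*} [Field K] [Algebra F K] {s : E} {d : F}
    (hs : s ^ 2 = algebraMap F E d) (hd : ¬IsSquare d) (hK : IsSquare (algebraMap F K d)) :
    Nonempty (F⟮s⟯ →ₐ[F] K) := by
  obtain ⟨z, hz⟩ := hK
  refine ⟨(algHomAdjoinIntegralEquiv F (isIntegral_of_sq_eq hs)).symm ⟨z, ?_⟩⟩
  rw [Polynomial.mem_aroots, minpoly_eq_of_sq_eq hs hd]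
  refine ⟨(Polynomial.monic_X_pow_sub_C d two_ne_zero).ne_zero, ?_⟩
  simp [hz, sq]

end Adjoin

section Main

theorem NumberField.RingOfIntegers.exists_sq_eq_natCast {L : Type*} [Field L] {s : L} {m : ℕ}
    (hs : s ^ 2 = m) : ∃ t : 𝓞 L, (t : L) = s ∧ t ^ 2 = m := by
  have h : IsIntegral ℤ s := IsIntegral.of_pow two_pos (hs ▸ isIntegral_natCast m)
  obtain ⟨t, rfl⟩ : ∃ t : 𝓞 L, algebraMap (𝓞 L) L t = s := ⟨⟨s, h⟩, rfl⟩
  refine ⟨t, rfl, FaithfulSMul.algebraMap_injective (𝓞 L) L ?_⟩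
  rw [map_pow, map_natCast, hs]

theorem odd_card_classGroup_tower {F₁ F₂ F₃ : Type*} [Field F₁] [NumberField F₁] [Field F₂]
    [NumberField F₂] [Field F₃] [NumberField F₃] [Algebra.IsQuadraticExtension ℚ F₁]
    [Algebra F₁ F₂] [Algebra.IsQuadraticExtension F₁ F₂] [Algebra F₂ F₃]
    [Algebra.IsQuadraticExtension F₂ F₃] {p q : ℕ} [Fact p.Prime] [Fact q.Prime]
    (hp : p % 8 = 5) (hq : q % 4 = 3) {s₁ : F₁} (hs₁ : s₁ ^ 2 = q) {s₂ : F₂} (hs₂ : s₂ ^ 2 = p)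
    {s₃ : F₃} (hs₃ : s₃ ^ 2 = 2) (hd₁ : ¬IsSquare (q : ℚ)) (hd₂ : ¬IsSquare (p : F₁))
    (hd₃ : ¬IsSquare (2 : F₂)) (φ : F₁ →+* ℚ_[p]) : Odd (Nat.card (ClassGroup (𝓞 F₃))) := by
  have hr₁ : IsTotallyReal F₁ := isTotallyReal_of_sq_eq_natCast (F := ℚ) hs₁ hd₁
  have hr₂ : IsTotallyReal F₂ := isTotallyReal_of_sq_eq_natCast hs₂ hd₂
  obtain ⟨t₁, -, ht₁⟩ := RingOfIntegers.exists_sq_eq_natCast hs₁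
  obtain ⟨t₂, -, ht₂⟩ := RingOfIntegers.exists_sq_eq_natCast hs₂
  obtain ⟨t₃, -, ht₃⟩ := RingOfIntegers.exists_sq_eq_natCast (m := 2) (by simpa using hs₃)
  have hn₁ := finrank_rat_of_isQuadraticExtension ℚ F₁
  have hn₂ := finrank_rat_of_isQuadraticExtension F₁ F₂
  have hn₃ := finrank_rat_of_isQuadraticExtension F₂ F₃
  rw [finrank_self] at hn₁
  have h₁ := odd_card_classGroup_of_sq_eq_prime_of_rat hq ht₁
  obtain ⟨γ, u, hγ⟩ := exists_sq_eq_two_mul_unit hq ht₁ h₁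
  have h₂ := odd_card_classGroup_of_sq_eq_prime h₁ hγ hp φ hd₂ ht₂ (by lia)
  refine odd_card_classGroup_of_sq_eq_two h₂ (γ := algebraMap (𝓞 F₁) (𝓞 F₂) γ)
    (u := u.map (algebraMap (𝓞 F₁) (𝓞 F₂))) ?_ hp ht₂ hd₃ (by simpa using ht₃) (by lia)
  rw [← map_pow, hγ, map_mul, map_ofNat]
  rfl

theorem Nat.Prime.not_isSquare_mul {p m : ℕ} (hp : p.Prime) (hm : ¬p ∣ m) : ¬IsSquare (p * m) := by
  rintro ⟨a, ha⟩
  obtain ⟨b, rfl⟩ : p ∣ a := by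
    have : p ∣ a * a := ha ▸ dvd_mul_right p m
    exact (or_self_iff.1 ((Nat.Prime.dvd_mul hp).1 this))
  exact hm ⟨b * b, Nat.eq_of_mul_eq_mul_left hp.pos (by rw [ha]; ring)⟩

theorem isQuadraticExtension_toRatAlgebra {L : Type*} [Field L] [CharZero L] [A : Algebra ℚ L]
    [h : Algebra.IsQuadraticExtension ℚ L] :
    @Algebra.IsQuadraticExtension ℚ L _ _ _ DivisionRing.toRatAlgebra := by
  obtain rfl : A = DivisionRing.toRatAlgebra := Subsingleton.elim _ _
  exact h

theorem mem_adjoin_adjoin_adjoin {F E : Type*} [Field F] [Field E] [Algebra F E] (a b c x : E) :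
    x ∈ F⟮a⟯⟮b⟯⟮c⟯ ↔ x ∈ adjoin F {c, b, a} := by
  have h : (F⟮a⟯⟮b⟯⟮c⟯.restrictScalars F⟮a⟯).restrictScalars F = adjoin F {c, b, a} := by
    rw [adjoin_adjoin_left, adjoin_adjoin_left]
    congr 1
    ext
    simp
  rw [← h]
  rfl

end Main

theorem odd_classNumber_Qsqrt2_sqrtp_sqrtq_legendre_one
    (p q : ℕ) [Fact (Nat.Prime p)] [Fact (Nat.Prime q)]
    (hp : p % 8 = 5) (hq : q % 8 = 3) (hleg : legendreSym q (p : ℤ) = 1) :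
    Odd (Nat.card (ClassGroup (integralClosure ℤ
      (IntermediateField.adjoin ℚ
        {Real.sqrt 2, Real.sqrt p, Real.sqrt q} : IntermediateField ℚ ℝ)))) := by
  have hpp : p.Prime := Fact.out
  have hqp : q.Prime := Fact.out
  have hpq : ¬p ∣ q := fun h => by
    have := (Nat.prime_dvd_prime_iff_eq hpp hqp).1 h
    lia
  have hd₁ : ¬IsSquare (q : ℚ) := by
    rw [Rat.isSquare_natCast_iff]
    exact hqp.prime.not_isSquare
  have hs₁ : √(q : ℝ) ^ 2 = algebraMap ℚ ℝ q := by simp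
  have hQ₁ := isQuadraticExtension_adjoin_of_sq_eq hs₁ hd₁
  obtain ⟨φ⟩ : Nonempty (ℚ⟮√(q : ℝ)⟯ →ₐ[ℚ] ℚ_[p]) := by
    refine nonempty_algHom_adjoin_of_sq_eq hs₁ hd₁ ?_
    have h := isSquare_padicInt_of_legendreSym_eq_one (r := p) (m := q) (by rintro rfl; lia) (by
      rwa [← legendreSym.quadratic_reciprocity_one_mod_four (by lia) (by rintro rfl; lia)])
    simpa using h.map (PadicInt.Coe.ringHom (p := p))
  have hQ₁' := isQuadraticExtension_toRatAlgebra (h := hQ₁)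
  have : NumberField ℚ⟮√(q : ℝ)⟯ := NumberField.of_module_finite ℚ _
  have hg₁ : AdjoinSimple.gen ℚ √(q : ℝ) ^ 2 = (q : ℚ⟮√(q : ℝ)⟯) :=
    Subtype.ext (by simp)
  have hns₁ {m : ℕ} (h1 : ¬IsSquare m) (h2 : ¬IsSquare (m * q)) :
      ¬IsSquare (m : ℚ⟮√(q : ℝ)⟯) := fun h => by
    rcases isSquare_or_isSquare_mul (F := ℚ) (d := (q : ℚ)) (m := (m : ℚ)) (by simpa using hg₁) hd₁
      (by simpa using h) with h | h
    · exact h1 (Rat.isSquare_natCast_iff.1 h)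
    · exact h2 (Rat.isSquare_natCast_iff.1 (by exact_mod_cast h))
  have hd₂ : ¬IsSquare (p : ℚ⟮√(q : ℝ)⟯) :=
    hns₁ hpp.prime.not_isSquare (hpp.not_isSquare_mul hpq)
  have hs₂ : √(p : ℝ) ^ 2 = algebraMap ℚ⟮√(q : ℝ)⟯ ℝ p := by simp
  have hQ₂ := isQuadraticExtension_adjoin_of_sq_eq hs₂ hd₂
  have : NumberField ℚ⟮√(q : ℝ)⟯⟮√(p : ℝ)⟯ := NumberField.of_module_finite ℚ⟮√(q : ℝ)⟯ _
  have hg₂ : AdjoinSimple.gen ℚ⟮√(q : ℝ)⟯ √(p : ℝ) ^ 2 = (p : ℚ⟮√(q : ℝ)⟯⟮√(p : ℝ)⟯) :=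
    Subtype.ext (by simp)
  have h2 : Nat.Prime 2 := Nat.prime_two
  have hd₃ : ¬IsSquare (2 : ℚ⟮√(q : ℝ)⟯⟮√(p : ℝ)⟯) := fun h => by
    rcases isSquare_or_isSquare_mul (F := ℚ⟮√(q : ℝ)⟯) (d := (p : ℚ⟮√(q : ℝ)⟯))
      (m := ((2 : ℕ) : ℚ⟮√(q : ℝ)⟯)) (by simpa using hg₂) hd₂
      (by rwa [map_natCast, Nat.cast_ofNat]) with h | h
    · exact hns₁ h2.prime.not_isSquare (h2.not_isSquare_mul (by lia)) h
    · refine hns₁ (m := 2 * p) (h2.not_isSquare_mul (by lia)) ?_ (by exact_mod_cast h)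
      rw [mul_assoc]
      refine h2.not_isSquare_mul ?_
      rw [h2.dvd_mul]
      lia
  have hs₃ : √(2 : ℝ) ^ 2 = algebraMap ℚ⟮√(q : ℝ)⟯⟮√(p : ℝ)⟯ ℝ 2 := by
    rw [map_ofNat]
    exact Real.sq_sqrt zero_le_two
  have hQ₃ := isQuadraticExtension_adjoin_of_sq_eq hs₃ hd₃
  have : NumberField ℚ⟮√(q : ℝ)⟯⟮√(p : ℝ)⟯⟮√(2 : ℝ)⟯ :=
    NumberField.of_module_finite ℚ⟮√(q : ℝ)⟯⟮√(p : ℝ)⟯ _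
  have hg₃ : AdjoinSimple.gen ℚ⟮√(q : ℝ)⟯⟮√(p : ℝ)⟯ √(2 : ℝ) ^ 2 = 2 :=
    Subtype.ext (Real.sq_sqrt zero_le_two)
  have key := odd_card_classGroup_tower hp (by lia) hg₁ hg₂ hg₃ hd₁ hd₂ hd₃ φ.toRingHom
  let e : adjoin ℚ {√(2 : ℝ), √(p : ℝ), √(q : ℝ)} ≃+* ℚ⟮√(q : ℝ)⟯⟮√(p : ℝ)⟯⟮√(2 : ℝ)⟯ :=
    { toFun x := ⟨x, (mem_adjoin_adjoin_adjoin _ _ _ _).2 x.2⟩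
      invFun x := ⟨x, (mem_adjoin_adjoin_adjoin _ _ _ _).1 x.2⟩
      map_add' _ _ := rfl
      map_mul' _ _ := rfl }
  rwa [← Nat.card_congr (ClassGroup.mulEquiv (RingOfIntegers.mapRingEquiv e)).toEquiv] at key
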